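/- Fix τ, σ ≥ 1 and let x = σ/gcd(τ, σ). For each n, choose an n-state 2-neighbor rule f uniformly at random, and let R^{(0,x)}_{τ,σ,n} be the set of weakly robust periodic solutions of f with temporal period τ and spatial period σ whose tile is simple and has rank x. Then there exists a constant c(τ, σ) > 0 depending only on τ and σ such that n^x · P(R^{(0,x)}_{τ,σ,n} ≠ ∅) → c(τ, σ) as n → ∞; that is, P(R^{(0,x)}_{τ,σ,n} ≠ ∅) = c(τ, σ)/n^x + o(1/n^x). -/

import Mathlib

open Filter

/-- An `n`-state 2-neighbor cellular automaton rule. -/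
abbrev CARule (n : ℕ) := Fin n → Fin n → Fin n

/-- One step of the CA evolution: `ξ_{t+1}(x) = f(ξ_t(x-1), ξ_t(x))`. -/
def caStep {n : ℕ} (f : CARule n) (ξ : ℤ → Fin n) : ℤ → Fin n :=
  fun x => f (ξ (x - 1)) (ξ x)

/-- The trajectory of an initial configuration under the rule `f`. -/
def caTraj {n : ℕ} (f : CARule n) (ξ : ℤ → Fin n) : ℕ → ℤ → Fin n
  | 0 => ξ
  | t + 1 => caStep f (caTraj f ξ t)

/-- `ξ` is (the initial configuration of) a periodic solution of `f` with
minimal temporal period `τ` and minimal spatial period `σ`. -/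
def IsPS {n : ℕ} (f : CARule n) (ξ : ℤ → Fin n) (τ σ : ℕ) : Prop :=
  0 < τ ∧ 0 < σ ∧
  (∀ x : ℤ, ξ (x + (σ : ℤ)) = ξ x) ∧
  (∀ σ' : ℕ, 0 < σ' → (∀ x : ℤ, ξ (x + (σ' : ℤ)) = ξ x) → σ ≤ σ') ∧
  caTraj f ξ τ = ξ ∧
  (∀ τ' : ℕ, 0 < τ' → caTraj f ξ τ' = ξ → τ ≤ τ')

/-- `η` is a proper initial configuration for the periodic solution `ξ`:
it agrees with `ξ` at all sites `≤ y` for some `y`. -/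
def IsProper {n : ℕ} (ξ η : ℤ → Fin n) : Prop :=
  ∃ y : ℤ, ∀ x ≤ y, η x = ξ x

/-- The periodic solution `ξ` of `f` is weakly robust: the expansion velocity is
positive, i.e. there is `v > 0` such that for every proper initial configuration
`η`, eventually (in `t`) the two trajectories agree at all sites `x ≤ v·t`
(equivalently, `inf_η liminf_t s_t(η)/t > 0`). -/
def IsWeaklyRobust {n : ℕ} (f : CARule n) (ξ : ℤ → Fin n) : Prop :=
  ∃ v : ℝ, 0 < v ∧ ∀ η : ℤ → Fin n, IsProper ξ η →
    ∀ᶠ t : ℕ in atTop, ∀ x : ℤ, (x : ℝ) ≤ v * t → caTraj f η t x = caTraj f ξ t x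

/-- The label (τ-periodic sequence) `A` right-extends to `B` under `f`: `A → B`. -/
def RightExtends {n : ℕ} (f : CARule n) (A B : ℕ → Fin n) : Prop :=
  ∀ i : ℕ, f (A i) (B i) = B (i + 1)

/-- The sequence `c_{j+1} = f(a_j, c_j)` started at `c₀`. -/
def chaseSeq {n : ℕ} (f : CARule n) (A : ℕ → Fin n) (c₀ : Fin n) : ℕ → Fin n
  | 0 => c₀
  | j + 1 => f (A j) (chaseSeq f A c₀ j)

/-- The label `A` decides `B` under `f`: `A ⇒ B`. -/
def Decides {n : ℕ} (f : CARule n) (A B : ℕ → Fin n) : Prop :=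
  RightExtends f A B ∧ ∀ c₀ : Fin n, ∃ j : ℕ, chaseSeq f A c₀ j = B j

/-- `T` is a (τ,σ)-periodic array (row index mod τ, column index mod σ). -/
def IsTilePeriodic {n : ℕ} (τ σ : ℕ) (T : ℕ → ℕ → Fin n) : Prop :=
  (∀ i j, T (i + τ) j = T i j) ∧ (∀ i j, T i (j + σ) = T i j)

/-- The set of states appearing in the tile `T`. -/
def tileStates (n τ σ : ℕ) (T : ℕ → ℕ → Fin n) : Finset (Fin n) :=
  (Finset.range τ ×ˢ Finset.range σ).image fun p => T p.1 p.2

/-- The set of horizontally adjacent pairs appearing in the tile `T`. -/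
def tilePairs (n τ σ : ℕ) (T : ℕ → ℕ → Fin n) : Finset (Fin n × Fin n) :=
  (Finset.range τ ×ˢ Finset.range σ).image fun p => (T p.1 p.2, T p.1 (p.2 + 1))

/-- `T` is a tile of a periodic solution: uniqueness of assignment, each row has
minimal period `σ`, and the cyclic sequence of rows has minimal period `τ`. -/
def IsPSTile (n τ σ : ℕ) (T : ℕ → ℕ → Fin n) : Prop :=
  IsTilePeriodic τ σ T ∧
  (∀ i j k m, T i j = T k m → T i (j + 1) = T k (m + 1) →
      T (i + 1) (j + 1) = T (k + 1) (m + 1)) ∧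
  (∀ i : ℕ, ∀ σ' : ℕ, 0 < σ' → (∀ j, T i (j + σ') = T i j) → σ ≤ σ') ∧
  (∀ τ' : ℕ, 0 < τ' → (∀ i j, T (i + τ') j = T i j) → τ ≤ τ')

/-- `T` is a tile of a periodic solution of the given rule `f`. -/
def IsPSTileOf {n : ℕ} (f : CARule n) (τ σ : ℕ) (T : ℕ → ℕ → Fin n) : Prop :=
  IsTilePeriodic τ σ T ∧
  (∀ i j, f (T i j) (T i (j + 1)) = T (i + 1) (j + 1)) ∧
  (∀ i : ℕ, ∀ σ' : ℕ, 0 < σ' → (∀ j, T i (j + σ') = T i j) → σ ≤ σ') ∧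
  (∀ τ' : ℕ, 0 < τ' → (∀ i j, T (i + τ') j = T i j) → τ ≤ τ')

/-- `T` is simple: the assignment number `p(T)` equals the number of states `s(T)`. -/
def IsSimpleTile (n τ σ : ℕ) (T : ℕ → ℕ → Fin n) : Prop :=
  (tilePairs n τ σ T).card = (tileStates n τ σ T).card

/-- The rank of a tile: the largest `x` such that some `x` columns of `T`
together contain `x * τ` pairwise distinct states. -/
noncomputable def tileRank (n τ σ : ℕ) (T : ℕ → ℕ → Fin n) : ℕ :=
  sSup {x : ℕ | ∃ J : Finset ℕ, J ⊆ Finset.range σ ∧ J.card = x ∧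
    ((J ×ˢ Finset.range τ).image fun p => T p.2 p.1).card = x * τ}

/-- The tile of the periodic solution `ξ` of `f`: `a_{i,j} = ξ_i(j)`. -/
def psTile {n : ℕ} (f : CARule n) (ξ : ℤ → Fin n) : ℕ → ℕ → Fin n :=
  fun i j => caTraj f ξ i (j : ℤ)

/-- The probability of the event `P` under the uniform distribution on a finite type. -/
noncomputable def pr {Ω : Type*} [Fintype Ω] (P : Ω → Prop) : ℝ :=
  (Nat.card {ω // P ω} : ℝ) / Fintype.card Ω

section Probability

variable {Ω : Type*} [Fintype Ω]

lemma pr_nonneg (P : Ω → Prop) : 0 ≤ pr P := by unfold pr; positivity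

lemma pr_mono {P Q : Ω → Prop} (h : ∀ ω, P ω → Q ω) : pr P ≤ pr Q := by
  unfold pr
  gcongr
  exact Nat.card_le_card_of_injective (Subtype.map id h) (Subtype.map_injective h Function.injective_id)

lemma pr_congr {P Q : Ω → Prop} (h : ∀ ω, P ω ↔ Q ω) : pr P = pr Q := by
  rw [show P = Q from funext fun ω => propext (h ω)]

lemma pr_true [Nonempty Ω] : pr (fun _ : Ω => True) = 1 := by
  unfold pr
  rw [Nat.card_congr (Equiv.subtypeUnivEquiv (fun _ => trivial)), Nat.card_eq_fintype_card]
  exact div_self (by exact_mod_cast Fintype.card_ne_zero)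

lemma pr_eq_sum [DecidableEq Ω] (P : Ω → Prop) [DecidablePred P] :
    pr P = (∑ ω, if P ω then (1 : ℝ) else 0) / Fintype.card Ω := by
  unfold pr
  rw [Finset.sum_boole, Nat.card_eq_fintype_card, Fintype.card_subtype]

lemma pr_equiv {Ω' : Type*} [Fintype Ω'] (e : Ω ≃ Ω') (P : Ω' → Prop) :
    pr (fun ω => P (e ω)) = pr P := by
  unfold pr
  rw [Fintype.card_congr e, Nat.card_congr (e.subtypeEquiv fun _ => Iff.rfl)]

end Probability

section Independence

variable {α Y : Type*} [Fintype α] [DecidableEq α] [Fintype Y] [Nonempty Y]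

/-- Events determined by disjoint sets of coordinates are independent. -/
theorem pr_and_of_dependsOn {P Q : (α → Y) → Prop} {s t : Set α} (hP : DependsOn P s)
    (hQ : DependsOn Q t) (hst : Disjoint s t) :
    pr (fun f => P f ∧ Q f) = pr P * pr Q := by
  classical
  have hP' : ∀ f g, P (s.piecewise f g) ↔ P f := fun f g =>
    iff_of_eq (hP fun i hi => by simp [hi])
  have hQ' : ∀ f g, Q (s.piecewise f g) ↔ Q g := fun f g =>
    iff_of_eq (hQ fun i hi => by simp [Set.disjoint_right.1 hst hi])
  let e : {f // P f ∧ Q f} × (α → Y) ≃ {f // P f} × {f // Q f} :=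
    { toFun := fun p => (⟨s.piecewise p.1.1 p.2, (hP' _ _).2 p.1.2.1⟩,
        ⟨s.piecewise p.2 p.1.1, (hQ' _ _).2 p.1.2.2⟩)
      invFun := fun p => (⟨s.piecewise p.1.1 p.2.1, (hP' _ _).2 p.1.2, (hQ' _ _).2 p.2.2⟩,
        s.piecewise p.2.1 p.1.1)
      left_inv := fun p => by
        ext i <;> by_cases hi : i ∈ s <;> simp [hi]
      right_inv := fun p => by
        ext i <;> by_cases hi : i ∈ s <;> simp [hi] }
  have h := Nat.card_congr e
  rw [Nat.card_prod, Nat.card_prod, Nat.card_eq_fintype_card (α := α → Y)] at h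
  have h0 : (Fintype.card (α → Y) : ℝ) ≠ 0 := by exact_mod_cast Fintype.card_ne_zero
  unfold pr
  field_simp
  exact_mod_cast h

omit [Fintype α] [DecidableEq α] [Fintype Y] [Nonempty Y] in
lemma dependsOn_forall_mem {ι : Type*} {I : Finset ι} {P : ι → (α → Y) → Prop}
    {s : ι → Set α} (hP : ∀ i ∈ I, DependsOn (P i) (s i)) :
    DependsOn (fun f => ∀ i ∈ I, P i f) (⋃ i ∈ I, s i) := fun f g h => by
  refine propext (forall₂_congr fun i hi => iff_of_eq (hP i hi fun a ha => h a ?_))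
  exact Set.mem_biUnion hi ha

theorem pr_forall_mem {ι : Type*} (I : Finset ι) {P : ι → (α → Y) → Prop}
    {s : ι → Set α} (hP : ∀ i ∈ I, DependsOn (P i) (s i))
    (hs : ∀ i ∈ I, ∀ j ∈ I, i ≠ j → Disjoint (s i) (s j)) :
    pr (fun f => ∀ i ∈ I, P i f) = ∏ i ∈ I, pr (P i) := by
  classical
  induction I using Finset.induction_on with
  | empty => simpa using pr_true
  | insert i I hi ih =>
    rw [Finset.prod_insert hi, ← ih (fun j hj => hP j (Finset.mem_insert_of_mem hj))
      (fun j hj k hk => hs j (Finset.mem_insert_of_mem hj) k (Finset.mem_insert_of_mem hk)),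
      ← pr_and_of_dependsOn (hP i (Finset.mem_insert_self i I))
        (dependsOn_forall_mem fun j hj => hP j (Finset.mem_insert_of_mem hj))]
    · exact pr_congr fun f => by simp
    · simp only [Set.disjoint_iUnion_right]
      intro j hj
      exact hs i (Finset.mem_insert_self i I) j (Finset.mem_insert_of_mem hj)
        (fun h => hi (h ▸ hj))

/-- Restricting a uniformly random function along an injection gives a uniformly random function. -/
theorem pr_comp_injective {V : Type*} [Fintype V] [DecidableEq V] {e : V → α}
    (he : Function.Injective e) (P : (V → Y) → Prop) :
    pr (fun f : α → Y => P (fun v => f (e v))) = pr P := by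
  classical
  let E : (α → Y) ≃ (V → Y) × (((Set.range e)ᶜ : Set α) → Y) :=
    (Equiv.arrowCongr ((Equiv.Set.sumCompl (Set.range e)).symm.trans
      (Equiv.sumCongr (Equiv.ofInjective e he).symm (Equiv.refl _))) (Equiv.refl Y)).trans
      (Equiv.sumArrowEquivProdArrow _ _ _)
  have hE : ∀ f, (E f).1 = fun v => f (e v) := by
    intro f
    ext v
    simp [E, Equiv.sumArrowEquivProdArrow, Equiv.arrowCongr]
  have h1 : Nat.card {f : α → Y // P (fun v => f (e v))} =
      Nat.card {F // P F} * Fintype.card (((Set.range e)ᶜ : Set α) → Y) := by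
    rw [← Nat.card_eq_fintype_card, ← Nat.card_prod]
    refine Nat.card_congr ((E.subtypeEquiv (q := fun p => P p.1) fun f => by rw [hE]).trans ?_)
    exact (Equiv.prodSubtypeFstEquivSubtypeProd (p := P))
  have h2 : (Fintype.card (((Set.range e)ᶜ : Set α) → Y) : ℝ) ≠ 0 := by
    exact_mod_cast Fintype.card_ne_zero
  unfold pr
  rw [h1, Fintype.card_congr E, Fintype.card_prod, Nat.cast_mul, Nat.cast_mul,
    mul_div_mul_right _ _ h2]

lemma pr_apply_eq [DecidableEq Y] (a : α) (y : Y) :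
    pr (fun f : α → Y => f a = y) = 1 / Fintype.card Y := by
  rw [pr_comp_injective (V := Unit) (e := fun _ => a) (fun _ _ _ => rfl) (fun F => F () = y)]
  refine (pr_equiv (Equiv.funUnique Unit Y) (fun z => z = y)).trans ?_
  unfold pr
  simp

end Independence

section Absorption

variable {V : Type*} [Fintype V] [DecidableEq V]

/-- The matrix `1 - P` where `P` is the substochastic matrix of the partial map `g`. -/
def partialMapMatrix (g : V → Option V) : Matrix V V ℝ :=
  Matrix.of fun v w => (if v = w then 1 else 0) - if g v = some w then 1 else 0

lemma det_partialMapMatrix_of_wellFounded (g : V → Option V)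
    (h : WellFounded fun w v => g v = some w) : (partialMapMatrix g).det = 1 := by
  have : IsWellFounded V (fun w v => g v = some w) := ⟨h⟩
  let b : V → Ordinalᵒᵈ := fun v => OrderDual.toDual (IsWellFounded.rank (fun w v => g v = some w) v)
  have hb : ∀ v w, g v = some w → b v < b w := fun v w hvw =>
    OrderDual.toDual_lt_toDual.2 (IsWellFounded.rank_lt_of_rel (r := fun w v => g v = some w) hvw)
  have hT : (partialMapMatrix g).BlockTriangular b := by
    intro v w hvw
    have h1 : v ≠ w := by rintro rfl; exact lt_irrefl _ hvw
    have h2 : g v ≠ some w := fun h2 => lt_asymm hvw (hb v w h2)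
    simp [partialMapMatrix, h1, h2]
  classical
  rw [hT.det]
  refine Finset.prod_eq_one fun k _ => ?_
  suffices (partialMapMatrix g).toSquareBlock b k = 1 by rw [this, Matrix.det_one]
  ext ⟨v, hv⟩ ⟨w, hw⟩
  have h2 : g v ≠ some w := fun h2 => by
    have := hb v w h2
    rw [hv, hw] at this
    exact lt_irrefl _ this
  simp [Matrix.toSquareBlock_def, partialMapMatrix, h2, Matrix.one_apply, Subtype.ext_iff]

lemma det_partialMapMatrix_of_not_wellFounded (g : V → Option V)
    (h : ¬ WellFounded fun w v => g v = some w) : (partialMapMatrix g).det = 0 := by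
  classical
  rw [← Matrix.exists_mulVec_eq_zero_iff]
  have hne : ∃ v, ¬ Acc (fun w v => g v = some w) v := by
    by_contra! hc
    exact h ⟨hc⟩
  refine ⟨fun v => if Acc (fun w v => g v = some w) v then 0 else 1, ?_, ?_⟩
  · obtain ⟨v, hv⟩ := hne
    intro h0
    have := congrFun h0 v
    simp [hv] at this
  · ext v
    simp only [Matrix.mulVec, dotProduct, partialMapMatrix, Matrix.of_apply, sub_mul, ite_mul,
      one_mul, zero_mul, Finset.sum_sub_distrib, Finset.sum_ite_eq, Finset.mem_univ, if_true,
      Pi.zero_apply]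
    rcases hg : g v with _ | u
    · have : Acc (fun w v => g v = some w) v := ⟨_, fun w hw => by simp [hg] at hw⟩
      simp [this]
    · have : Acc (fun w v => g v = some w) v ↔ Acc (fun w v => g v = some w) u :=
        ⟨fun ha => ha.inv hg, fun ha => ⟨_, fun w hw => by
          rw [hg, Option.some_inj] at hw; rwa [← hw]⟩⟩
      simp [this]

open scoped Classical in
lemma det_partialMapMatrix (g : V → Option V) :
    (partialMapMatrix g).det = if WellFounded fun w v => g v = some w then 1 else 0 := by
  split_ifs with h
  · exact det_partialMapMatrix_of_wellFounded g h
  · exact det_partialMapMatrix_of_not_wellFounded g h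

end Absorption

section Cycle

variable {τ : ℕ} [NeZero τ]

lemma wellFounded_cycle_iff (b : ZMod τ → Bool) :
    (WellFounded fun w v : ZMod τ => (if b v then some (v + 1) else none) = some w) ↔
      ∃ j, b j = false := by
  constructor
  · intro h
    by_contra! hc
    obtain ⟨m, -, hm⟩ := h.has_min Set.univ ⟨0, trivial⟩
    exact hm (m + 1) trivial (by simp [hc m])
  · rintro ⟨j, hj⟩
    have key : ∀ k : ℕ, Acc (fun w v : ZMod τ => (if b v then some (v + 1) else none) = some w)
        (j - k) := by
      intro k
      induction k with
      | zero => exact ⟨_, fun w hw => by simp [hj] at hw⟩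
      | succ k ih =>
        refine ⟨_, fun w hw => ?_⟩
        split_ifs at hw
        rw [Option.some_inj] at hw
        rw [← hw]
        convert ih using 1
        push_cast
        ring
    refine ⟨fun v => ?_⟩
    have := key (j - v).val
    rwa [ZMod.natCast_val, ZMod.cast_id', id, sub_sub_cancel] at this

lemma det_one_sub_weighted_cycle (q : ZMod τ → ℝ) :
    (1 - Matrix.of fun j k : ZMod τ => if j + 1 = k then q j else 0).det = 1 - ∏ j, q j := by
  classical
  let row : ZMod τ → Bool → ZMod τ → ℝ := fun j b k =>
    (if j = k then 1 else 0) - if (if b then some (j + 1) else none) = some k then 1 else 0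
  have hrow : (1 - Matrix.of fun j k : ZMod τ => if j + 1 = k then q j else 0) =
      fun j => ∑ b : Bool, (if b then q j else 1 - q j) • row j b := by
    ext j k
    simp only [Matrix.sub_apply, Matrix.one_apply, Matrix.of_apply, Fintype.sum_bool, if_true,
      Pi.add_apply, Pi.smul_apply, smul_eq_mul, row, Option.some_inj]
    split_ifs <;> simp_all
  have hdet : ∀ b : ZMod τ → Bool, Matrix.detRowAlternating (fun j => row j (b j)) =
      if ∃ j, b j = false then (1 : ℝ) else 0 := by
    intro b
    have := det_partialMapMatrix (fun v : ZMod τ => if b v then some (v + 1) else none)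
    simp only [wellFounded_cycle_iff] at this
    exact this
  have h1 : (1 - Matrix.of fun j k : ZMod τ => if j + 1 = k then q j else 0).det =
      ∑ b : ZMod τ → Bool, (∏ j, if b j then q j else 1 - q j) *
        if ∃ j, b j = false then (1 : ℝ) else 0 := by
    rw [hrow]
    have := (Matrix.detRowAlternating (n := ZMod τ) (R := ℝ)).toMultilinearMap.map_sum
      (fun j (b : Bool) => (if b then q j else 1 - q j) • row j b)
    refine this.trans (Finset.sum_congr rfl fun b _ => ?_)
    rw [← hdet b, ← smul_eq_mul]
    exact (Matrix.detRowAlternating (n := ZMod τ) (R := ℝ)).toMultilinearMap.map_smul_univ _ _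
  have h2 : ∑ b : ZMod τ → Bool, (∏ j, if b j then q j else 1 - q j) = 1 := by
    have := Finset.prod_univ_sum (fun _ : ZMod τ => (Finset.univ : Finset Bool))
      (fun j b => if b then q j else 1 - q j)
    rw [Fintype.piFinset_univ] at this
    rw [← this]
    exact Finset.prod_eq_one fun j _ => by simp
  rw [h1, eq_sub_iff_add_eq]
  refine Eq.trans ?_ h2
  rw [← Finset.sum_erase_add _ _ (Finset.mem_univ (fun _ => true)),
    ← Finset.sum_erase_add Finset.univ (fun b : ZMod τ → Bool => ∏ j, if b j then q j else 1 - q j)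
      (Finset.mem_univ (fun _ => true))]
  simp only [Bool.true_eq_false, exists_const, if_false, mul_zero, add_zero, if_true]
  congr 1
  refine Finset.sum_congr rfl fun b hb => ?_
  have : ∃ j, b j = false := by
    by_contra! hc
    exact Finset.ne_of_mem_erase hb (funext fun j => by simpa using hc j)
  rw [if_pos this, mul_one]

end Cycle

section Levels

variable {τ : ℕ} [NeZero τ] {Y : Type*} [Fintype Y] [DecidableEq Y]

/-- The partial map on the complement of `R` that moves to the next level along `F`. -/
def levelMap (R : Finset (ZMod τ × Y)) (F : {v // v ∉ R} → Y) (v : {v // v ∉ R}) :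
    Option {v // v ∉ R} :=
  if h : (v.1.1 + 1, F v) ∈ R then none else some ⟨(v.1.1 + 1, F v), h⟩

omit [NeZero τ] [Fintype Y] in
lemma levelMap_eq_some_iff {R : Finset (ZMod τ × Y)} {F : {v // v ∉ R} → Y}
    {v w : {v // v ∉ R}} : levelMap R F v = some w ↔ (v.1.1 + 1, F v) = w.1 := by
  unfold levelMap
  split_ifs with h
  · simp only [false_iff]
    intro h'
    exact w.2 (h' ▸ h)
  · rw [Option.some_inj, Subtype.ext_iff]

lemma sum_det_levelMap [Nonempty Y] (R : Finset (ZMod τ × Y)) :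
    ∑ F : {v // v ∉ R} → Y, (partialMapMatrix (levelMap R F)).det =
      (Fintype.card Y : ℝ) ^ Fintype.card {v // v ∉ R} *
        (1 - ∏ i : ZMod τ,
          (1 - (Finset.univ.filter fun c => (i, c) ∈ R).card / (Fintype.card Y : ℝ))) := by
  classical
  set N : ℝ := (Fintype.card Y : ℝ) with hN
  have hN0 : N ≠ 0 := by rw [hN]; exact_mod_cast Fintype.card_ne_zero
  let row : {v // v ∉ R} → Y → {v // v ∉ R} → ℝ := fun v y w =>
    (if v = w then 1 else 0) - if (v.1.1 + 1, y) = w.1 then 1 else 0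
  have h1 : ∑ F : {v // v ∉ R} → Y, (partialMapMatrix (levelMap R F)).det =
      (Matrix.of fun v w => ∑ y, row v y w).det := by
    have := (Matrix.detRowAlternating (n := {v // v ∉ R}) (R := ℝ)).toMultilinearMap.map_sum row
    have h : (Matrix.of fun v w => ∑ y, row v y w) = fun v => ∑ y, row v y := by
      ext v w
      exact (Finset.sum_apply w Finset.univ (row v)).symm
    rw [h]
    refine Eq.trans (Finset.sum_congr rfl fun F _ => ?_) this.symm
    congr 1
    ext v w
    simp [partialMapMatrix, row, levelMap_eq_some_iff]
  let A : Matrix {v // v ∉ R} (ZMod τ) ℝ := Matrix.of fun v l => if v.1.1 + 1 = l then N⁻¹ else 0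
  let B : Matrix (ZMod τ) {v // v ∉ R} ℝ := Matrix.of fun l v => if l = v.1.1 then 1 else 0
  have h2 : (Matrix.of fun v w => ∑ y, row v y w) = N • (1 - A * B) := by
    ext v w
    simp only [row, Finset.sum_sub_distrib, Finset.sum_const, Finset.card_univ,
      Matrix.smul_apply, Matrix.sub_apply, Matrix.mul_apply, A, B, Matrix.of_apply, smul_eq_mul,
      mul_ite, mul_one, mul_zero, nsmul_eq_mul, ← hN, Matrix.one_apply, mul_sub]
    congr 1
    rw [Finset.sum_ite_eq']
    simp only [Finset.mem_univ, if_true, Prod.ext_iff]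
    by_cases h : v.1.1 + 1 = w.1.1
    · simp [h, hN0]
    · simp [h]
  have h3 : B * A = Matrix.of fun j k : ZMod τ => if j + 1 = k then
      1 - (Finset.univ.filter fun c => (j, c) ∈ R).card / N else 0 := by
    ext j k
    simp only [Matrix.mul_apply, A, B, Matrix.of_apply, ite_mul, one_mul, zero_mul]
    rw [← Finset.sum_filter]
    have : ∀ v ∈ Finset.univ.filter (fun v : {v // v ∉ R} => j = v.1.1),
        (if v.1.1 + 1 = k then N⁻¹ else 0) = if j + 1 = k then N⁻¹ else 0 := by
      intro v hv
      rw [(Finset.mem_filter.1 hv).2]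
    rw [Finset.sum_congr rfl this, Finset.sum_const, nsmul_eq_mul, mul_ite, mul_zero]
    congr 1
    have hc : (Finset.univ.filter (fun v : {v // v ∉ R} => j = v.1.1)).card =
        (Finset.univ.filter fun c => (j, c) ∉ R).card := by
      refine Finset.card_bij (fun v _ => v.1.2) ?_ ?_ ?_
      · rintro ⟨⟨i, c⟩, hv⟩ h
        simp only [Finset.mem_filter, Finset.mem_univ, true_and] at h ⊢
        subst h
        exact hv
      · rintro ⟨⟨i, c⟩, hv⟩ h ⟨⟨i', c'⟩, hv'⟩ h' hcc
        simp_all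
      · intro c hc
        exact ⟨⟨(j, c), (Finset.mem_filter.1 hc).2⟩, by simp, rfl⟩
    have hs := Finset.card_filter_add_card_filter_not (s := (Finset.univ : Finset Y))
      (fun c => (j, c) ∈ R)
    rw [Finset.card_univ] at hs
    have hs' : N = ((Finset.univ.filter fun c => (j, c) ∈ R).card : ℝ) +
      (Finset.univ.filter fun c => (j, c) ∉ R).card := by rw [hN, ← hs]; push_cast; rfl
    rw [hc, eq_sub_of_add_eq' hs'.symm]
    field_simp
  rw [h1, h2, Matrix.det_smul, Matrix.det_one_sub_mul_comm, h3, det_one_sub_weighted_cycle]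

theorem pr_wellFounded_levelMap [Nonempty Y] (R : Finset (ZMod τ × Y)) :
    pr (fun F : {v // v ∉ R} → Y => WellFounded fun w v => levelMap R F v = some w) =
      1 - ∏ i : ZMod τ,
          (1 - (Finset.univ.filter fun c => (i, c) ∈ R).card / (Fintype.card Y : ℝ)) := by
  classical
  have h0 : (Fintype.card Y : ℝ) ^ Fintype.card {v // v ∉ R} ≠ 0 :=
    pow_ne_zero _ (by exact_mod_cast Fintype.card_ne_zero)
  rw [pr_eq_sum, Fintype.card_fun, Nat.cast_pow, div_eq_iff h0, mul_comm _ (_ ^ _),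
    ← sum_det_levelMap]
  exact Finset.sum_congr rfl fun F _ => (det_partialMapMatrix _).symm

/-- One step of the dynamics `(i, c) ↦ (i + 1, f (a i, c))`. -/
def chaseStep (f : Y × Y → Y) (a : ZMod τ → Y) (v : ZMod τ × Y) : ZMod τ × Y :=
  (v.1 + 1, f (a v.1, v.2))

/-- All orbits of the dynamics driven by `a` reach the set `R`. -/
def Absorbed (f : Y × Y → Y) (a : ZMod τ → Y) (R : Finset (ZMod τ × Y)) : Prop :=
  ∀ v, ∃ k, (chaseStep f a)^[k] v ∈ R

omit [NeZero τ] [Fintype Y] in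
lemma absorbed_iff_wellFounded (f : Y × Y → Y) (a : ZMod τ → Y) (R : Finset (ZMod τ × Y)) :
    Absorbed f a R ↔ WellFounded fun w v : {v // v ∉ R} =>
      levelMap R (fun v => f (a v.1.1, v.1.2)) v = some w := by
  simp only [levelMap_eq_some_iff]
  constructor
  · intro h
    have key : ∀ k : ℕ, ∀ v : {v // v ∉ R}, (chaseStep f a)^[k] v.1 ∈ R →
        Acc (fun w v : {v // v ∉ R} => (v.1.1 + 1, f (a v.1.1, v.1.2)) = w.1) v := by
      intro k
      induction k with
      | zero => exact fun v hv => absurd hv v.2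
      | succ k ih =>
        intro v hv
        refine ⟨_, fun w hw => ih w ?_⟩
        rw [← hw]
        exact hv
    exact ⟨fun v => (h v.1).elim fun k hk => key k v hk⟩
  · intro h v
    by_cases hv : v ∈ R
    · exact ⟨0, hv⟩
    · have key : ∀ v : {v // v ∉ R}, ∃ k, (chaseStep f a)^[k] v.1 ∈ R := by
        intro v
        induction v using h.induction with
        | _ v ih =>
          by_cases hw : chaseStep f a v.1 ∈ R
          · exact ⟨1, hw⟩
          · obtain ⟨k, hk⟩ := ih ⟨_, hw⟩ rfl
            exact ⟨k + 1, hk⟩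
      exact key ⟨v, hv⟩

omit [NeZero τ] [Fintype Y] in
lemma dependsOn_absorbed (a : ZMod τ → Y) (R : Finset (ZMod τ × Y)) :
    DependsOn (fun f : Y × Y → Y => Absorbed f a R) {p | ∃ v ∉ R, p = (a v.1, v.2)} := by
  intro f g h
  have : (fun v : {v // v ∉ R} => f (a v.1.1, v.1.2)) = fun v => g (a v.1.1, v.1.2) :=
    funext fun v => h _ ⟨v.1, v.2, rfl⟩
  simp only [absorbed_iff_wellFounded, this]

theorem pr_absorbed [Nonempty Y] {a : ZMod τ → Y} (ha : Function.Injective a)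
    (R : Finset (ZMod τ × Y)) :
    pr (fun f : Y × Y → Y => Absorbed f a R) = 1 - ∏ i : ZMod τ,
      (1 - (Finset.univ.filter fun c => (i, c) ∈ R).card / (Fintype.card Y : ℝ)) := by
  rw [← pr_wellFounded_levelMap, ← pr_comp_injective (α := Y × Y)
    (e := fun v : {v // v ∉ R} => (a v.1.1, v.1.2))]
  · exact pr_congr fun f => absorbed_iff_wellFounded f a R
  · rintro ⟨⟨i, c⟩, h⟩ ⟨⟨i', c'⟩, h'⟩ hh
    simp only [Prod.mk.injEq, ha.eq_iff] at hh
    simp [hh.1, hh.2]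

end Levels

section Tiles

variable {τ σ : ℕ} [NeZero τ] [NeZero σ]

lemma zmod_prod_induction {P : ZMod τ × ZMod σ → Prop} (h0 : P 0)
    (hright : ∀ w, P w → P (w + (0, 1))) (hdiag : ∀ w, P w → P (w + (1, 1))) : ∀ w, P w := by
  have h1 : ∀ k : ℕ, P ((k : ZMod τ), (k : ZMod σ)) := by
    intro k
    induction k with
    | zero => simpa [← Prod.zero_eq_mk] using h0
    | succ k ih => simpa using hdiag _ ih
  have h2 : ∀ k l : ℕ, P ((k : ZMod τ), (k : ZMod σ) + (l : ZMod σ)) := by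
    intro k l
    induction l with
    | zero => simpa using h1 k
    | succ l ih => simpa [add_assoc] using hright _ ih
  intro w
  have := h2 w.1.val (w.2 - (w.1.val : ZMod σ)).val
  simpa only [ZMod.natCast_zmod_val, add_sub_cancel] using this

/-- The subgroup meets both coordinate axes trivially. -/
structure AxisFree (H : AddSubgroup (ZMod τ × ZMod σ)) : Prop where
  vertical : ∀ j, ((0 : ZMod τ), j) ∈ H → j = 0
  horizontal : ∀ i, (i, (0 : ZMod σ)) ∈ H → i = 0

variable {H : AddSubgroup (ZMod τ × ZMod σ)}

omit [NeZero τ] [NeZero σ] in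
lemma nsmul_eq_zero_of_mem (w : ZMod τ × ZMod σ) (hw : w ∈ H) : Nat.card H • w = 0 := by
  have := card_nsmul_eq_zero' (x := (⟨w, hw⟩ : H))
  exact congrArg Subtype.val this

omit [NeZero τ] [NeZero σ] in
lemma AxisFree.card_dvd (hH : AxisFree H) : Nat.card H ∣ σ := by
  have hinj : Function.Injective ((AddMonoidHom.snd (ZMod τ) (ZMod σ)).comp H.subtype) := by
    rw [injective_iff_map_eq_zero]
    rintro ⟨⟨i, j⟩, h⟩ h0
    have hj : j = 0 := h0
    subst hj
    simp [hH.horizontal i h]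
  have := AddSubgroup.card_dvd_of_injective _ hinj
  rwa [Nat.card_zmod] at this

variable {x : ℕ}

/-- The sites in the first `x` columns. -/
def repSite (p : ZMod τ × Fin x) : ZMod τ × ZMod σ := (p.1, ((p.2 : ℕ) : ZMod σ))

lemma AxisFree.repSite_injective (hH : AxisFree H) (hx : x * Nat.card H = σ) :
    Function.Injective fun p : ZMod τ × Fin x => (QuotientAddGroup.mk (repSite p) :
      (ZMod τ × ZMod σ) ⧸ H) := by
  have key : ∀ j j' : Fin x, ∀ i : ZMod τ,
      (i, ((j : ℕ) : ZMod σ) - ((j' : ℕ) : ZMod σ)) ∈ H → (j' : ℕ) ≤ j → j = j' := by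
    intro j j' i h hle
    have h1 := congrArg Prod.snd (nsmul_eq_zero_of_mem _ h)
    rw [Prod.smul_snd, Prod.snd_zero, ← Nat.cast_sub hle, nsmul_eq_mul, ← Nat.cast_mul,
      ZMod.natCast_eq_zero_iff] at h1
    nth_rewrite 1 [← hx] at h1
    rw [mul_comm x] at h1
    have h2 := Nat.eq_zero_of_dvd_of_lt (Nat.dvd_of_mul_dvd_mul_left Nat.card_pos h1)
      (by have := j.2; omega)
    exact Fin.ext (by omega)
  rintro ⟨i, j⟩ ⟨i', j'⟩ h
  have h' : (i' - i, ((j' : ℕ) : ZMod σ) - ((j : ℕ) : ZMod σ)) ∈ H := by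
    rw [QuotientAddGroup.eq, neg_add_eq_sub] at h
    exact h
  have hj : j = j' := by
    rcases le_total (j : ℕ) j' with hle | hle
    · exact (key j' j _ h' hle).symm
    · refine key j j' (i - i') ?_ hle
      have := H.neg_mem h'
      simpa using this
  subst hj
  rw [sub_self] at h'
  have := hH.horizontal _ h'
  rw [sub_eq_zero] at this
  rw [this]

lemma AxisFree.card_quotient (hx : x * Nat.card H = σ) :
    Nat.card ((ZMod τ × ZMod σ) ⧸ H) = τ * x := by
  have h := H.card_eq_card_quotient_mul_card_addSubgroup
  rw [Nat.card_prod, Nat.card_zmod, Nat.card_zmod] at h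
  have hpos : 0 < Nat.card H := Nat.card_pos
  refine Nat.eq_of_mul_eq_mul_right hpos ?_
  rw [← h, mul_assoc, hx]

lemma AxisFree.repSite_bijective (hH : AxisFree H) (hx : x * Nat.card H = σ) :
    Function.Bijective fun p : ZMod τ × Fin x => (QuotientAddGroup.mk (repSite p) :
      (ZMod τ × ZMod σ) ⧸ H) := by
  refine (hH.repSite_injective hx).bijective_of_nat_card_le ?_
  rw [AxisFree.card_quotient hx, Nat.card_prod, Nat.card_zmod, Nat.card_fin]

lemma AxisFree.exists_repSite (hH : AxisFree H) (hx : x * Nat.card H = σ)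
    (u : ZMod τ × ZMod σ) : ∃ p : ZMod τ × Fin x, u - repSite p ∈ H := by
  obtain ⟨p, hp⟩ := (hH.repSite_bijective hx).2 (QuotientAddGroup.mk u)
  refine ⟨p, ?_⟩
  rw [QuotientAddGroup.eq, neg_add_eq_sub] at hp
  exact hp

variable {Y : Type*}

/-- The array `T` takes equal values exactly at sites congruent modulo `H`. -/
def IsTile (H : AddSubgroup (ZMod τ × ZMod σ)) (T : ZMod τ × ZMod σ → Y) : Prop :=
  ∀ u v, T u = T v ↔ u - v ∈ H

variable {T : ZMod τ × ZMod σ → Y}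

omit [NeZero τ] [NeZero σ] in
lemma IsTile.unique {H' : AddSubgroup (ZMod τ × ZMod σ)} (h : IsTile H T) (h' : IsTile H' T) :
    H = H' := by
  ext w
  rw [← sub_zero w, ← h, ← h']

omit [NeZero τ] [NeZero σ] in
lemma IsTile.add_mem (h : IsTile H T) {w : ZMod τ × ZMod σ} (hw : w ∈ H) (u : ZMod τ × ZMod σ) :
    T (u + w) = T u := (h _ _).2 (by simpa using hw)

omit [NeZero τ] [NeZero σ] in
lemma IsTile.add_right (h : IsTile H T) {u v : ZMod τ × ZMod σ} (huv : T u = T v)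
    (w : ZMod τ × ZMod σ) : T (u + w) = T (v + w) := (h _ _).2 (by simpa using (h _ _).1 huv)

omit [NeZero τ] [NeZero σ] in
lemma IsTile.translate (h : IsTile H T) (w : ZMod τ × ZMod σ) : IsTile H fun u => T (u + w) :=
  fun u v => by rw [h]; simp

lemma IsTile.comp_repSite_injective (h : IsTile H T) (hH : AxisFree H)
    (hx : x * Nat.card H = σ) : Function.Injective fun p : ZMod τ × Fin x => T (repSite p) := by
  intro p q hpq
  refine hH.repSite_injective hx ?_
  simp only [QuotientAddGroup.eq, neg_add_eq_sub]
  exact (h _ _).1 hpq.symm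

lemma IsTile.exists_repSite (h : IsTile H T) (hH : AxisFree H)
    (hx : x * Nat.card H = σ) (u : ZMod τ × ZMod σ) :
    ∃ p : ZMod τ × Fin x, T (repSite p) = T u := by
  obtain ⟨p, hp⟩ := hH.exists_repSite hx u
  exact ⟨p, ((h _ _).2 hp).symm⟩

lemma IsTile.card_image [DecidableEq Y] (h : IsTile H T) (hH : AxisFree H)
    (hx : x * Nat.card H = σ) : (Finset.univ.image T).card = τ * x := by
  have : Finset.univ.image T = Finset.univ.image fun p : ZMod τ × Fin x => T (repSite p) := by
    ext y
    simp only [Finset.mem_image, Finset.mem_univ, true_and]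
    constructor
    · rintro ⟨u, rfl⟩
      exact h.exists_repSite hH hx u
    · rintro ⟨p, rfl⟩
      exact ⟨_, rfl⟩
  rw [this, Finset.card_image_of_injective _ (h.comp_repSite_injective hH hx), Finset.card_univ,
    Fintype.card_prod, ZMod.card, Fintype.card_fin]

lemma card_isTile [Fintype Y] (hH : AxisFree H) (hx : x * Nat.card H = σ) :
    Nat.card {T : ZMod τ × ZMod σ → Y // IsTile H T} = (Fintype.card Y).descFactorial (τ * x) := by
  classical
  let E := Equiv.ofBijective _ (hH.repSite_bijective hx)
  have hE : ∀ u, u - repSite (E.symm (QuotientAddGroup.mk u)) ∈ H := fun u => by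
    have := E.apply_symm_apply (QuotientAddGroup.mk u)
    simp only [E, Equiv.ofBijective_apply, QuotientAddGroup.eq, neg_add_eq_sub] at this
    exact this
  let e : {T : ZMod τ × ZMod σ → Y // IsTile H T} ≃ (ZMod τ × Fin x ↪ Y) :=
    { toFun := fun T => ⟨fun p => T.1 (repSite p), T.2.comp_repSite_injective hH hx⟩
      invFun := fun φ => ⟨fun u => φ (E.symm (QuotientAddGroup.mk u)), fun u v => by
        rw [φ.injective.eq_iff, E.symm.injective.eq_iff, eq_comm, QuotientAddGroup.eq,
          neg_add_eq_sub]⟩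
      left_inv := fun T => by
        ext u
        exact ((T.2 _ _).2 (hE u)).symm
      right_inv := fun φ => by
        ext p
        change φ (E.symm (E p)) = φ p
        rw [E.symm_apply_apply] }
  rw [Nat.card_congr e, Nat.card_eq_fintype_card, Fintype.card_embedding_eq, Fintype.card_prod,
    ZMod.card, Fintype.card_fin]

end Tiles

section RobustTiles

variable {τ σ : ℕ} [NeZero τ] [NeZero σ] {Y : Type*} [DecidableEq Y]

/-- The rule `f` generates the array `T`. -/
def Compat (f : Y × Y → Y) (T : ZMod τ × ZMod σ → Y) : Prop :=
  ∀ u, f (T u, T (u + (0, 1))) = T (u + (1, 1))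

/-- Column `j + 1` of `T`, as a set of pairs (time, state). -/
def nextColumn (T : ZMod τ × ZMod σ → Y) (j : ZMod σ) : Finset (ZMod τ × Y) :=
  Finset.univ.image fun i => (i, T (i, j + 1))

/-- The rule `f` generates `T`, and each column of `T` decides the next one. -/
def RobustTile (f : Y × Y → Y) (T : ZMod τ × ZMod σ → Y) : Prop :=
  Compat f T ∧ ∀ j, Absorbed f (fun i => T (i, j)) (nextColumn T j)

omit [NeZero σ] in
lemma mem_nextColumn {T : ZMod τ × ZMod σ → Y} {j : ZMod σ} {i : ZMod τ} {c : Y} :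
    (i, c) ∈ nextColumn T j ↔ c = T (i, j + 1) := by
  simp only [nextColumn, Finset.mem_image, Finset.mem_univ, true_and, Prod.mk.injEq]
  constructor
  · rintro ⟨i', rfl, rfl⟩; rfl
  · rintro rfl; exact ⟨i, rfl, rfl⟩

omit [NeZero τ] [DecidableEq Y] in
lemma Absorbed.shift [DecidableEq Y] {f : Y × Y → Y} {a : ZMod τ → Y} {R R' : Finset (ZMod τ × Y)}
    (h : Absorbed f a R)
    (k : ZMod τ) (hR : ∀ v ∈ R, (v.1 - k, v.2) ∈ R') : Absorbed f (fun i => a (i + k)) R' := by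
  have key : ∀ (m : ℕ) v, (chaseStep f fun i => a (i + k))^[m] (v.1 - k, v.2) =
      (((chaseStep f a)^[m] v).1 - k, ((chaseStep f a)^[m] v).2) := by
    intro m
    induction m with
    | zero => exact fun _ => rfl
    | succ m ih =>
      intro v
      rw [Function.iterate_succ_apply, Function.iterate_succ_apply, ← ih]
      congr 1
      simp only [chaseStep, sub_add_cancel, Prod.mk.injEq, and_true]
      ring
  rintro ⟨i, c⟩
  obtain ⟨m, hm⟩ := h (i + k, c)
  refine ⟨m, ?_⟩
  have := key m (i + k, c)
  simp only [add_sub_cancel_right] at this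
  rw [this]
  exact hR _ hm

omit [NeZero σ] in
lemma Absorbed.translate {f : Y × Y → Y} {T : ZMod τ × ZMod σ → Y} (w : ZMod τ × ZMod σ)
    {j : ZMod σ} (h : Absorbed f (fun i => T (i, j + w.2)) (nextColumn T (j + w.2))) :
    Absorbed f (fun i => T ((i, j) + w)) (nextColumn (fun u => T (u + w)) j) := by
  refine h.shift w.1 ?_
  rintro ⟨i, c⟩ hc
  rw [mem_nextColumn] at hc ⊢
  rw [hc]
  refine congrArg T (Prod.ext ?_ ?_)
  · simp
  · simp only [Prod.snd_add]; ring

omit [NeZero σ] in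
lemma RobustTile.translate {f : Y × Y → Y} {T : ZMod τ × ZMod σ → Y} (h : RobustTile f T)
    (w : ZMod τ × ZMod σ) : RobustTile f fun u => T (u + w) := by
  refine ⟨fun u => ?_, fun j => (h.2 (j + w.2)).translate w⟩
  have := h.1 (u + w)
  rwa [add_right_comm u w, add_right_comm u w] at this

variable {x : ℕ} {H : AddSubgroup (ZMod τ × ZMod σ)} {T : ZMod τ × ZMod σ → Y}

lemma robustTile_iff (h : IsTile H T) (hH : AxisFree H) (hx : x * Nat.card H = σ) (f : Y × Y → Y) :
    RobustTile f T ↔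
      (∀ p : ZMod τ × Fin x, f (T (repSite p), T (repSite p + (0, 1))) = T (repSite p + (1, 1))) ∧
      ∀ j : Fin x, Absorbed f (fun i => T (i, ((j : ℕ) : ZMod σ)))
        (nextColumn T ((j : ℕ) : ZMod σ)) := by
  refine ⟨fun hf => ⟨fun p => hf.1 _, fun j => hf.2 _⟩, fun hf => ⟨fun u => ?_, fun j => ?_⟩⟩
  · obtain ⟨p, hp⟩ := h.exists_repSite hH hx u
    rw [← hp, ← h.add_right hp, ← h.add_right hp]
    exact hf.1 p
  · obtain ⟨⟨i, j'⟩, hp⟩ := hH.exists_repSite hx (0, j)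
    set w : ZMod τ × ZMod σ := (i, ((j' : ℕ) : ZMod σ) - j) with hw
    have hwH : w ∈ H := by
      have := H.neg_mem hp
      simpa [repSite, hw] using this
    have hT : (fun u => T (u + w)) = T := funext fun u => h.add_mem hwH u
    have hj : j + w.2 = ((j' : ℕ) : ZMod σ) := by simp [hw]
    have := hf.2 j'
    rw [← hj] at this
    have h2 := this.translate w
    rw [hT] at h2
    convert h2 using 2 with i'
    exact (h.add_mem hwH _).symm

/-! ### Dependency sets -/

omit [NeZero σ] [NeZero τ] [DecidableEq Y] in
lemma dependsOn_cell (a b d : Y) :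
    DependsOn (fun f : Y × Y → Y => f (a, b) = d) {(a, b)} := fun f g h => by
  simp only [h (a, b) rfl]

omit [NeZero σ] in
lemma dependsOn_robustTile (T : ZMod τ × ZMod σ → Y) :
    DependsOn (fun f : Y × Y → Y => RobustTile f T) {p | p.1 ∈ Set.range T} := by
  intro f g h
  have h1 : ∀ u c, f (T u, c) = g (T u, c) := fun u c => h _ ⟨u, rfl⟩
  have h2 : ∀ j, chaseStep f (fun i => T (i, j)) = chaseStep g fun i => T (i, j) := fun j => by
    funext v
    exact Prod.ext rfl (h1 _ _)
  simp only [RobustTile, Compat, Absorbed, h1, h2]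

/-! ### Probabilities -/

variable [Fintype Y] [Nonempty Y]

lemma pr_forall_cells (h : IsTile H T) (hH : AxisFree H) (hx : x * Nat.card H = σ)
    (I : Finset (ZMod τ × Fin x)) :
    pr (fun f : Y × Y → Y => ∀ p ∈ I,
      f (T (repSite p), T (repSite p + (0, 1))) = T (repSite p + (1, 1))) =
      (1 / (Fintype.card Y : ℝ)) ^ I.card := by
  rw [pr_forall_mem I (fun p _ => dependsOn_cell (T (repSite p)) (T (repSite p + (0, 1)))
    (T (repSite p + (1, 1))))]
  · rw [Finset.prod_congr rfl fun p _ => pr_apply_eq _ _, Finset.prod_const]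
  · intro p _ q _ hpq
    rw [Set.disjoint_singleton]
    intro hc
    exact hpq (h.comp_repSite_injective hH hx (Prod.mk.inj hc).1)

omit [NeZero τ] [NeZero σ] [DecidableEq Y] [Fintype Y] [Nonempty Y] in
lemma IsTile.column_injective (h : IsTile H T) (hH : AxisFree H) (j : ZMod σ) :
    Function.Injective fun i => T (i, j) := by
  intro i i' hii
  have := (h _ _).1 hii
  rw [Prod.mk_sub_mk, sub_self] at this
  exact sub_eq_zero.1 (hH.horizontal _ this)

omit [NeZero σ] in
lemma pr_absorbed_nextColumn (h : IsTile H T) (hH : AxisFree H) (j : ZMod σ) :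
    pr (fun f : Y × Y → Y => Absorbed f (fun i => T (i, j)) (nextColumn T j)) =
      1 - (1 - 1 / (Fintype.card Y : ℝ)) ^ τ := by
  rw [pr_absorbed (h.column_injective hH j)]
  simp only [mem_nextColumn, Finset.filter_eq', Finset.mem_univ, if_true, Finset.card_singleton,
    Finset.prod_const, Finset.card_univ, ZMod.card, Nat.cast_one]

lemma pr_absorbed_le {a : ZMod τ → Y} (ha : Function.Injective a) (R : Finset (ZMod τ × Y)) :
    pr (fun f : Y × Y → Y => Absorbed f a R) ≤ R.card / (Fintype.card Y : ℝ) := by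
  have hN : (0 : ℝ) < Fintype.card Y := by exact_mod_cast Fintype.card_pos
  have key : ∀ (r : ZMod τ → ℝ) (I : Finset (ZMod τ)), (∀ i, 0 ≤ r i ∧ r i ≤ 1) →
      1 - ∏ i ∈ I, (1 - r i) ≤ ∑ i ∈ I, r i ∧ 0 ≤ ∏ i ∈ I, (1 - r i) ∧
        ∏ i ∈ I, (1 - r i) ≤ 1 := by
    intro r I hr
    induction I using Finset.induction_on with
    | empty => simp
    | insert i I hi ih =>
      rw [Finset.prod_insert hi, Finset.sum_insert hi]
      have := hr i
      refine ⟨by nlinarith, by nlinarith, by nlinarith⟩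
  rw [pr_absorbed ha]
  refine (key _ _ fun i => ⟨by positivity, ?_⟩).1.trans ?_
  · rw [div_le_one hN]
    exact_mod_cast Finset.card_le_univ _
  · rw [← Finset.sum_div, ← Nat.cast_sum]
    gcongr
    rw [Finset.card_eq_sum_card_fiberwise (f := Prod.fst) (t := Finset.univ)
      (fun _ _ => Finset.mem_coe.2 (Finset.mem_univ _))]
    refine Finset.sum_le_sum fun i _ => ?_
    refine Finset.card_le_card_of_injOn (fun c => (i, c)) ?_ ?_
    · intro c hc
      simpa using hc
    · intro c _ c' _ hcc
      exact (Prod.mk.inj hcc).2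

omit [DecidableEq Y] [Fintype Y] [Nonempty Y] in
lemma IsTile.column_eq_imp (h : IsTile H T) (hH : AxisFree H) (hx : x * Nat.card H = σ)
    {i i' : ZMod τ} {j j' : Fin x}
    (e : T (i, ((j : ℕ) : ZMod σ)) = T (i', ((j' : ℕ) : ZMod σ))) : i = i' ∧ j = j' :=
  Prod.mk.inj (h.comp_repSite_injective hH hx (a₁ := (i, j)) (a₂ := (i', j')) e)

/-- The events that the rule generates the tile and that the columns reach given sets
containing the next columns are independent. -/
lemma pr_cells_and_columns (h : IsTile H T) (hH : AxisFree H) (hx : x * Nat.card H = σ)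
    (Q : Fin x → (Y × Y → Y) → Prop)
    (hQ : ∀ j : Fin x, DependsOn (Q j)
      {q | ∃ i c, c ≠ T (i, ((j : ℕ) : ZMod σ) + 1) ∧ q = (T (i, ((j : ℕ) : ZMod σ)), c)}) :
    pr (fun f : Y × Y → Y =>
      (∀ p ∈ (Finset.univ : Finset (ZMod τ × Fin x)),
        f (T (repSite p), T (repSite p + (0, 1))) = T (repSite p + (1, 1))) ∧
      ∀ j ∈ (Finset.univ : Finset (Fin x)), Q j f) =
      (1 / (Fintype.card Y : ℝ)) ^ (τ * x) * ∏ j, pr (Q j) := by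
  rw [pr_and_of_dependsOn
    (dependsOn_forall_mem fun p _ => dependsOn_cell (T (repSite p)) (T (repSite p + (0, 1)))
      (T (repSite p + (1, 1)))) (dependsOn_forall_mem fun j _ => hQ j),
    pr_forall_cells h hH hx, pr_forall_mem _ fun j _ => hQ j]
  · simp only [Finset.card_univ, Fintype.card_prod, ZMod.card, Fintype.card_fin]
  · intro j _ j' _ hjj
    rw [Set.disjoint_left]
    rintro _ ⟨i, c, -, rfl⟩ ⟨i', c', -, hc⟩
    exact hjj (h.column_eq_imp hH hx (Prod.mk.inj hc).1).2
  · simp only [Set.disjoint_iUnion_left, Set.disjoint_iUnion_right, Set.disjoint_singleton_left]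
    rintro j' - ⟨i, j⟩ - ⟨i', c, hc, he⟩
    obtain ⟨h1, h2⟩ := Prod.mk.inj he
    obtain ⟨rfl, rfl⟩ := h.column_eq_imp hH hx h1
    refine hc (h2.symm.trans ?_)
    simp [repSite]

omit [NeZero σ] [Fintype Y] [Nonempty Y] in
lemma dependsOn_column (j : ZMod σ) (R : Finset (ZMod τ × Y)) (hR : nextColumn T j ⊆ R) :
    DependsOn (fun f : Y × Y → Y => Absorbed f (fun i => T (i, j)) R)
      {q | ∃ i c, c ≠ T (i, j + 1) ∧ q = (T (i, j), c)} := by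
  refine (dependsOn_absorbed _ R).mono ?_
  rintro _ ⟨⟨i, c⟩, hv, rfl⟩
  exact ⟨i, c, fun hc => hv (hR (mem_nextColumn.2 hc)), rfl⟩

theorem pr_robustTile (h : IsTile H T) (hH : AxisFree H) (hx : x * Nat.card H = σ) :
    pr (fun f : Y × Y → Y => RobustTile f T) =
      (1 / (Fintype.card Y : ℝ)) ^ (τ * x) * (1 - (1 - 1 / (Fintype.card Y : ℝ)) ^ τ) ^ x := by
  have := pr_cells_and_columns h hH hx
    (fun j f => Absorbed f (fun i => T (i, ((j : ℕ) : ZMod σ))) (nextColumn T ((j : ℕ) : ZMod σ)))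
    fun j => dependsOn_column _ _ subset_rfl
  simp only [pr_absorbed_nextColumn h hH, Finset.prod_const, Finset.card_univ,
    Fintype.card_fin] at this
  rw [← this]
  exact pr_congr fun f => by simpa using robustTile_iff h hH hx f

/-- One additional prescribed value in a row used by the tile costs a factor of order
`1 / n`. -/
theorem pr_robustTile_and_cell_le (h : IsTile H T) (hH : AxisFree H) (hx : x * Nat.card H = σ)
    (u : ZMod τ × ZMod σ) (c d : Y) (hc : T (u + (0, 1)) ≠ c) :
    pr (fun f : Y × Y → Y => RobustTile f T ∧ f (T u, c) = d) ≤
      (1 / (Fintype.card Y : ℝ)) ^ (τ * x) *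
        (((τ + 1) / (Fintype.card Y : ℝ)) ^ x * (1 / (Fintype.card Y : ℝ))) := by
  obtain ⟨⟨i₀, j₀⟩, hp⟩ := h.exists_repSite hH hx u
  set N : ℝ := (Fintype.card Y : ℝ) with hN
  have hNpos : 0 < N := by rw [hN]; exact_mod_cast Fintype.card_pos
  have hc' : c ≠ T (i₀, ((j₀ : ℕ) : ZMod σ) + 1) := by
    rw [← h.add_right hp] at hc
    intro h'
    apply hc
    rw [h']
    simp [repSite]
  rw [← hp]
  let R : Fin x → Finset (ZMod τ × Y) := fun j =>
    if j = j₀ then insert (i₀, c) (nextColumn T ((j : ℕ) : ZMod σ))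
    else nextColumn T ((j : ℕ) : ZMod σ)
  have hR : ∀ j : Fin x, nextColumn T ((j : ℕ) : ZMod σ) ⊆ R j := fun j => by
    simp only [R]; split_ifs
    · exact Finset.subset_insert _ _
    · exact subset_rfl
  have hcard : ∀ j : ZMod σ, (nextColumn T j).card ≤ τ := fun j =>
    Finset.card_image_le.trans (by rw [Finset.card_univ, ZMod.card])
  have hRcard : ∀ j, (R j).card ≤ τ + 1 := fun j => by
    simp only [R]; split_ifs
    · exact (Finset.card_insert_le _ _).trans (by gcongr; exact hcard _)
    · exact (hcard _).trans (Nat.le_succ τ)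
  let Q : Fin x → (Y × Y → Y) → Prop := fun j f =>
    Absorbed f (fun i => T (i, ((j : ℕ) : ZMod σ))) (R j) ∧
      (j = j₀ → f (T (repSite (i₀, j₀)), c) = d)
  have hQ : ∀ j : Fin x, DependsOn (Q j)
      {q | ∃ i c, c ≠ T (i, ((j : ℕ) : ZMod σ) + 1) ∧ q = (T (i, ((j : ℕ) : ZMod σ)), c)} := by
    intro j f g hfg
    refine congrArg₂ And (dependsOn_column _ _ (hR j) hfg) (propext (forall_congr' ?_))
    rintro rfl
    rw [show f (T (repSite (i₀, j)), c) = g (T (repSite (i₀, j)), c) from hfg _ ⟨i₀, c, hc', rfl⟩]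
  have hQpr : ∀ j, pr (Q j) ≤ (τ + 1) / N * if j = j₀ then 1 / N else 1 := by
    intro j
    have h1 : pr (fun f : Y × Y → Y => Absorbed f (fun i => T (i, ((j : ℕ) : ZMod σ))) (R j)) ≤
        (τ + 1) / N := by
      refine (pr_absorbed_le (h.column_injective hH _) _).trans ?_
      gcongr
      exact_mod_cast hRcard j
    split_ifs with hj
    · have h2 : pr (Q j) = pr (fun f : Y × Y → Y =>
          Absorbed f (fun i => T (i, ((j : ℕ) : ZMod σ))) (R j)) * (1 / N) := by
        rw [hN, ← pr_apply_eq (T (repSite (i₀, j₀)), c) d,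
          ← pr_and_of_dependsOn (dependsOn_absorbed _ (R j)) (dependsOn_cell _ _ _)]
        · exact pr_congr fun f => by simp [Q, hj]
        · rw [Set.disjoint_singleton_right]
          rintro ⟨⟨i, c'⟩, hv, he⟩
          obtain ⟨h3, rfl⟩ := Prod.mk.inj he
          subst hj
          obtain ⟨rfl, -⟩ := h.column_eq_imp hH hx h3
          exact hv (by simp [R])
      rw [h2]
      gcongr
    · rw [mul_one]
      exact (pr_mono fun f hf => hf.1).trans h1
  calc _ ≤ pr (fun f : Y × Y → Y =>
      (∀ p ∈ (Finset.univ : Finset (ZMod τ × Fin x)),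
        f (T (repSite p), T (repSite p + (0, 1))) = T (repSite p + (1, 1))) ∧
      ∀ j ∈ (Finset.univ : Finset (Fin x)), Q j f) := by
        refine pr_mono fun f hf => ⟨fun p _ => hf.1.1 _, fun j _ => ⟨fun v => ?_, fun _ => hf.2⟩⟩
        obtain ⟨k, hk⟩ := hf.1.2 ((j : ℕ) : ZMod σ) v
        exact ⟨k, hR j hk⟩
    _ = (1 / N) ^ (τ * x) * ∏ j, pr (Q j) := pr_cells_and_columns h hH hx Q hQ
    _ ≤ (1 / N) ^ (τ * x) * ∏ j, ((τ + 1) / N * if j = j₀ then 1 / N else 1) := by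
        gcongr with j _
        · exact fun j _ => pr_nonneg _
        · exact hQpr j
    _ = _ := by
        rw [Finset.prod_mul_distrib, Finset.prod_ite_eq' Finset.univ j₀ (fun _ => 1 / N)]
        simp only [Finset.prod_const, Finset.card_univ, Fintype.card_fin, Finset.mem_univ, if_true]

/-! ### Pairs of tiles -/

variable {H' : AddSubgroup (ZMod τ × ZMod σ)} {T' : ZMod τ × ZMod σ → Y}

omit [DecidableEq Y] [Fintype Y] [Nonempty Y] in
/-- Two tiles of one rule that share a state either are translates of each other, or
a common state is followed by distinct states in the two tiles. -/
lemma exists_ne_of_not_translate [DecidableEq Y] {f : Y × Y → Y}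
    (hf : Compat f T) (hf' : Compat f T')
    (hne : ∀ w, T' ≠ fun u => T (u + w)) {u u' : ZMod τ × ZMod σ} (huu : T u = T' u') :
    ∃ u u', T u = T' u' ∧ T (u + (0, 1)) ≠ T' (u' + (0, 1)) := by
  by_contra! hc
  have key : ∀ w, ∀ u u', T u = T' u' → T (u + w) = T' (u' + w) := by
    intro w
    induction w using zmod_prod_induction with
    | h0 => simp
    | hright w ih =>
      intro u u' h
      rw [← add_assoc, ← add_assoc]
      exact hc _ _ (ih u u' h)
    | hdiag w ih =>
      intro u u' h
      rw [← add_assoc, ← add_assoc, ← hf, ← hf', ih u u' h, hc _ _ (ih u u' h)]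
  refine hne (u - u') (funext fun v => ?_)
  have := key (v - u') u u' huu
  rw [add_sub_cancel] at this
  rw [← this]
  congr 1
  abel

open scoped Classical in
theorem pr_robustTile_pair_le (h : IsTile H T) (hH : AxisFree H) (hx : x * Nat.card H = σ)
    (h' : IsTile H' T') (hH' : AxisFree H') (hx' : x * Nat.card H' = σ) (hx0 : 1 ≤ x)
    (hne : ∀ w, T' ≠ fun u => T (u + w)) :
    pr (fun f : Y × Y → Y => RobustTile f T ∧ RobustTile f T') ≤
      ((1 / (Fintype.card Y : ℝ)) ^ (τ * x) *
        (((τ + 1) / (Fintype.card Y : ℝ)) ^ x * (1 / (Fintype.card Y : ℝ)) * (τ + 1) ^ x)) *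
      ∏ p : ZMod τ × Fin x,
        if T' (repSite p) ∈ Set.range T then 1 else 1 / (Fintype.card Y : ℝ) := by
  set N : ℝ := (Fintype.card Y : ℝ) with hN
  have hN1 : 1 ≤ N := by rw [hN]; exact_mod_cast Fintype.card_pos
  have hNpos : 0 < N := by linarith
  have hτ1 : (1 : ℝ) ≤ (τ + 1 : ℝ) ^ x := one_le_pow₀ (by linarith [Nat.cast_nonneg (α := ℝ) τ])
  by_cases hex : ∃ f : Y × Y → Y, RobustTile f T ∧ RobustTile f T'
  swap
  · have : pr (fun f : Y × Y → Y => RobustTile f T ∧ RobustTile f T') = 0 := by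
      have hemp : IsEmpty {f : Y × Y → Y // RobustTile f T ∧ RobustTile f T'} :=
        ⟨fun f => hex ⟨f.1, f.2⟩⟩
      simp [pr]
    rw [this]
    refine mul_nonneg (by positivity) (Finset.prod_nonneg fun p _ => ?_)
    split_ifs <;> positivity
  obtain ⟨f₀, hf₀, hf₀'⟩ := hex
  have hprod : (∏ p : ZMod τ × Fin x, if T' (repSite p) ∈ Set.range T then 1 else 1 / N) =
      (1 / N) ^ (Finset.univ.filter fun p : ZMod τ × Fin x => T' (repSite p) ∉ Set.range T).card := by
    rw [Finset.prod_ite, Finset.prod_const_one, one_mul, Finset.prod_const]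
  by_cases hsh : ∃ u u', T u = T' u'
  · obtain ⟨u₁, u₁', hu₁⟩ := hsh
    obtain ⟨u, u', huu, hnext⟩ := exists_ne_of_not_translate hf₀.1 hf₀'.1 hne hu₁
    set I := Finset.univ.filter fun p : ZMod τ × Fin x => T' (repSite p) ∉ Set.range T with hI
    calc _ ≤ pr (fun f : Y × Y → Y =>
          (RobustTile f T ∧ f (T u, T' (u' + (0, 1))) = T' (u' + (1, 1))) ∧
          ∀ p ∈ I, f (T' (repSite p), T' (repSite p + (0, 1))) = T' (repSite p + (1, 1))) := by
          refine pr_mono fun f hf => ⟨⟨hf.1, ?_⟩, fun p _ => hf.2.1 _⟩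
          rw [huu]
          exact hf.2.1 u'
      _ = pr (fun f : Y × Y → Y => RobustTile f T ∧ f (T u, T' (u' + (0, 1))) = T' (u' + (1, 1))) *
          (1 / N) ^ I.card := by
          rw [hN, ← pr_forall_cells h' hH' hx']
          refine pr_and_of_dependsOn (s := {p | p.1 ∈ Set.range T})
            (t := ⋃ p ∈ I, {(T' (repSite p), T' (repSite p + (0, 1)))}) ?_
            (dependsOn_forall_mem fun p _ => dependsOn_cell _ _ _) ?_
          · intro f g hfg
            refine congrArg₂ And (dependsOn_robustTile T hfg) ?_
            rw [hfg (T u, T' (u' + (0, 1))) ⟨u, rfl⟩]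
          · simp only [Set.disjoint_iUnion_right, Set.disjoint_singleton_right]
            intro p hp
            exact (Finset.mem_filter.1 hp).2
      _ ≤ _ := by
          rw [hprod]
          gcongr
          refine (pr_robustTile_and_cell_le h hH hx u _ _ hnext).trans ?_
          rw [← hN]
          exact mul_le_mul_of_nonneg_left (le_mul_of_one_le_right (by positivity) hτ1)
            (by positivity)
  · push Not at hsh
    have hpr : ∀ {T : ZMod τ × ZMod σ → Y} {H : AddSubgroup (ZMod τ × ZMod σ)}, IsTile H T →
        AxisFree H → x * Nat.card H = σ → pr (fun f : Y × Y → Y => RobustTile f T) ≤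
          (1 / N) ^ (τ * x) * ((τ + 1) / N) ^ x := by
      intro T H h hH hx
      rw [pr_robustTile h hH hx, ← hN]
      have h01 : 0 ≤ 1 - (1 - 1 / N) ^ τ := by
        rw [hN, ← pr_absorbed_nextColumn h hH 0]
        exact pr_nonneg _
      gcongr
      rw [hN, ← pr_absorbed_nextColumn h hH 0]
      refine (pr_absorbed_le (h.column_injective hH _) _).trans ?_
      gcongr
      have : (nextColumn T 0).card ≤ τ :=
        Finset.card_image_le.trans (by rw [Finset.card_univ, ZMod.card])
      exact_mod_cast this.trans (Nat.le_succ τ)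
    have hfil : (Finset.univ.filter fun p : ZMod τ × Fin x =>
        T' (repSite p) ∉ Set.range T).card = τ * x := by
      rw [Finset.filter_true_of_mem, Finset.card_univ, Fintype.card_prod, ZMod.card,
        Fintype.card_fin]
      rintro p - ⟨u, hu⟩
      exact hsh _ _ hu
    rw [hprod, hfil, pr_and_of_dependsOn (dependsOn_robustTile T) (dependsOn_robustTile T')]
    · have h2 : ((τ + 1) / N) ^ x ≤ 1 / N * (τ + 1) ^ x := by
        rw [div_pow, div_eq_mul_one_div, mul_comm, ← one_div_pow]
        gcongr
        exact pow_le_of_le_one (by positivity) ((div_le_one hNpos).2 hN1) (by omega)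
      calc _ ≤ ((1 / N) ^ (τ * x) * ((τ + 1) / N) ^ x) * ((1 / N) ^ (τ * x) * ((τ + 1) / N) ^ x) :=
            mul_le_mul (hpr h hH hx) (hpr h' hH' hx') (pr_nonneg _) (by positivity)
        _ ≤ ((1 / N) ^ (τ * x) * ((τ + 1) / N) ^ x) *
            ((1 / N) ^ (τ * x) * (1 / N * (τ + 1) ^ x)) := by gcongr
        _ = _ := by ring
    · rw [Set.disjoint_left]
      rintro ⟨a, b⟩ ⟨u, hu⟩ ⟨u', hu'⟩
      exact hsh u u' (hu.trans hu'.symm)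

end RobustTiles

section CellularAutomata

variable {n τ σ : ℕ} [NeZero τ] [NeZero σ] {f : CARule n} {ξ : ℤ → Fin n}

lemma caTraj_eq_iterate (f : CARule n) (ξ : ℤ → Fin n) (t : ℕ) :
    caTraj f ξ t = (caStep f)^[t] ξ := by
  induction t with
  | zero => rfl
  | succ t ih => rw [Function.iterate_succ_apply', ← ih]; rfl

lemma caTraj_succ_add_one (f : CARule n) (ξ : ℤ → Fin n) (t : ℕ) (y : ℤ) :
    caTraj f ξ (t + 1) (y + 1) = f (caTraj f ξ t y) (caTraj f ξ t (y + 1)) := by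
  simp [caTraj, caStep]

/-- The array `T` on the discrete torus lists the trajectory of `ξ`. -/
def Represents (f : CARule n) (ξ : ℤ → Fin n) (T : ZMod τ × ZMod σ → Fin n) : Prop :=
  ∀ (t : ℕ) (y : ℤ), caTraj f ξ t y = T ((t : ZMod τ), (y : ZMod σ))

omit [NeZero τ] [NeZero σ] in
lemma Represents.psTile_apply {T : ZMod τ × ZMod σ → Fin n} (h : Represents f ξ T) (i j : ℕ) :
    psTile f ξ i j = T ((i : ZMod τ), (j : ZMod σ)) := by
  rw [psTile, h, Int.cast_natCast]

omit [NeZero τ] in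
lemma exists_represents (h : IsPS f ξ τ σ) :
    ∃ T : ZMod τ × ZMod σ → Fin n, Represents f ξ T := by
  refine ⟨fun u => caTraj f ξ u.1.val (u.2.val : ℤ), fun t y => ?_⟩
  obtain ⟨-, -, hσ, -, hτ, -⟩ := h
  have hper : ∀ t, Function.Periodic (caTraj f ξ t) (σ : ℤ) := by
    intro t
    induction t with
    | zero => exact hσ
    | succ t ih =>
      intro y
      simp only [caTraj, caStep, add_sub_right_comm y (σ : ℤ) 1]
      rw [ih, ih]
  rw [caTraj_eq_iterate] at hτ
  have h1 : caTraj f ξ (t % τ) = caTraj f ξ t := by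
    rw [caTraj_eq_iterate, caTraj_eq_iterate]
    exact Function.IsPeriodicPt.iterate_mod_apply hτ t
  simp only [ZMod.val_natCast, ZMod.val_intCast, h1]
  have h2 := ((hper t).int_mul (y / σ)) (y % σ)
  rw [Int.cast_id, mul_comm, Int.emod_add_mul_ediv] at h2
  exact h2

omit [NeZero τ] [NeZero σ] in
lemma Compat.represents {T : ZMod τ × ZMod σ → Fin n} (h : Compat (Function.uncurry f) T) :
    Represents f (fun y => T (0, (y : ZMod σ))) T := by
  intro t
  induction t with
  | zero => intro y; simp [caTraj]
  | succ t ih =>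
    intro y
    have := h ((t : ZMod τ), ((y - 1 : ℤ) : ZMod σ))
    simp only [Prod.mk_add_mk, add_zero, Function.uncurry_apply_pair] at this
    rw [caTraj, caStep, ih, ih]
    simpa using this

variable {T : ZMod τ × ZMod σ → Fin n} {H : AddSubgroup (ZMod τ × ZMod σ)}

lemma exists_cast_eq (u : ZMod τ × ZMod σ) : ∃ (t : ℕ) (y : ℤ), u = ((t : ZMod τ), (y : ZMod σ)) :=
  ⟨u.1.val, u.2.val, by simp⟩

lemma Represents.compat (h : Represents f ξ T) : Compat (Function.uncurry f) T := by
  intro u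
  obtain ⟨t, y, rfl⟩ := exists_cast_eq u
  have := caTraj_succ_add_one f ξ t y
  rw [h, h, h] at this
  simpa using this.symm

lemma Represents.axisFree (h : Represents f ξ T) (hps : IsPS f ξ τ σ) (hT : IsTile H T) :
    AxisFree H := by
  obtain ⟨-, -, -, hσ, -, hτ⟩ := hps
  constructor
  · intro j hj
    by_contra hne
    have := hσ j.val (Nat.pos_of_ne_zero fun h0 => hne ((ZMod.val_eq_zero j).1 h0)) fun y => by
      have h1 := h 0 (y + (j.val : ℤ))
      have h2 := h 0 y
      have h3 := hT.add_mem hj (0, (y : ZMod σ))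
      simp only [caTraj] at h1 h2
      rw [h1, h2]
      simpa using h3
    exact absurd (ZMod.val_lt j) (not_lt.2 this)
  · intro i hi
    by_contra hne
    have := hτ i.val (Nat.pos_of_ne_zero fun h0 => hne ((ZMod.val_eq_zero i).1 h0)) <| by
      funext y
      have h1 := h i.val y
      have h2 := h 0 y
      have h3 := hT.add_mem hi (0, (y : ZMod σ))
      simp only [caTraj] at h2
      rw [h1, h2]
      simpa using h3
    exact absurd (ZMod.val_lt i) (not_lt.2 this)

lemma Represents.isPS (h : Represents f ξ T) (hT : IsTile H T) (hH : AxisFree H) :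
    IsPS f ξ τ σ := by
  have h0 : ∀ y, ξ y = T (0, (y : ZMod σ)) := fun y => by simpa [caTraj] using h 0 y
  refine ⟨Nat.pos_of_neZero τ, Nat.pos_of_neZero σ, fun y => ?_, fun σ' hσ' hper => ?_, ?_,
    fun τ' hτ' hper => ?_⟩
  · simp [h0]
  · have h1 := hper 0
    rw [h0, h0, hT] at h1
    have h2 := hH.vertical _ (by simpa using h1)
    exact Nat.le_of_dvd hσ' ((ZMod.natCast_eq_zero_iff _ _).1 h2)
  · funext y
    rw [h, h0]
    simp
  · have h1 := congrFun hper 0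
    rw [h, h0, hT] at h1
    have h2 := hH.horizontal _ (by simpa using h1)
    exact Nat.le_of_dvd hτ' ((ZMod.natCast_eq_zero_iff _ _).1 h2)

lemma image_range_product {α : Type*} [DecidableEq α] (F : ZMod τ × ZMod σ → α) :
    ((Finset.range τ ×ˢ Finset.range σ).image fun p => F ((p.1 : ZMod τ), (p.2 : ZMod σ))) =
      Finset.univ.image F := by
  ext a
  simp only [Finset.mem_image, Finset.mem_product, Finset.mem_range, Finset.mem_univ, true_and]
  constructor
  · rintro ⟨p, -, rfl⟩
    exact ⟨_, rfl⟩
  · rintro ⟨u, rfl⟩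
    exact ⟨(u.1.val, u.2.val), ⟨ZMod.val_lt _, ZMod.val_lt _⟩, by simp⟩

lemma Represents.isSimpleTile_iff (h : Represents f ξ T) :
    IsSimpleTile n τ σ (psTile f ξ) ↔ ∀ u v, T u = T v → T (u + (0, 1)) = T (v + (0, 1)) := by
  have hs : tileStates n τ σ (psTile f ξ) = Finset.univ.image T := by
    rw [← image_range_product, tileStates]
    simp only [h.psTile_apply]
  have hp : tilePairs n τ σ (psTile f ξ) = Finset.univ.image fun u => (T u, T (u + (0, 1))) := by
    rw [← image_range_product, tilePairs]
    simp only [h.psTile_apply, Prod.mk_add_mk, add_zero, Nat.cast_add, Nat.cast_one]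
  have hfst : Finset.univ.image T =
      (Finset.univ.image fun u => (T u, T (u + (0, 1)))).image Prod.fst := by
    rw [Finset.image_image]; rfl
  rw [IsSimpleTile, hs, hp, hfst, eq_comm, Finset.card_image_iff]
  constructor
  · intro hi u v huv
    exact (Prod.mk.inj (hi (Finset.mem_coe.2 (Finset.mem_image_of_mem _ (Finset.mem_univ u)))
      (Finset.mem_coe.2 (Finset.mem_image_of_mem _ (Finset.mem_univ v))) huv)).2
  · intro hi a ha b hb hab
    obtain ⟨u, -, rfl⟩ := Finset.mem_image.1 (Finset.mem_coe.1 ha)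
    obtain ⟨v, -, rfl⟩ := Finset.mem_image.1 (Finset.mem_coe.1 hb)
    exact Prod.ext hab (hi u v hab)

lemma exists_isTile {F : Fin n × Fin n → Fin n} (hc : Compat F T)
    (hs : ∀ u v, T u = T v → T (u + (0, 1)) = T (v + (0, 1))) :
    ∃ H : AddSubgroup (ZMod τ × ZMod σ), IsTile H T := by
  have key : ∀ w, ∀ u v, T u = T v → T (u + w) = T (v + w) := by
    intro w
    induction w using zmod_prod_induction with
    | h0 => simp
    | hright w ih =>
      intro u v h
      rw [← add_assoc, ← add_assoc]
      exact hs _ _ (ih u v h)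
    | hdiag w ih =>
      intro u v h
      rw [← add_assoc, ← add_assoc, ← hc, ← hc, ih u v h, hs _ _ (ih u v h)]
  refine ⟨⟨⟨⟨{w | ∀ u, T (u + w) = T u}, fun {a b} ha hb u => ?_⟩, fun u => ?_⟩,
    fun {a} ha u => ?_⟩, fun u v => ⟨fun h z => ?_, fun h => ?_⟩⟩
  · rw [← add_assoc, hb, ha]
  · rw [add_zero]
  · rw [← ha (u + -a), neg_add_cancel_right]
  · have := key (z - v) u v h
    rw [add_sub_cancel] at this
    rw [← this]
    congr 1
    abel
  · have := h v
    rw [add_sub_cancel] at this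
    exact this

lemma Represents.tileRank_eq (h : Represents f ξ T) (hT : IsTile H T) (hH : AxisFree H)
    {x : ℕ} (hx : x * Nat.card H = σ) : tileRank n τ σ (psTile f ξ) = x := by
  refine IsGreatest.csSup_eq ⟨⟨Finset.range x, ?_, Finset.card_range x, ?_⟩, ?_⟩
  · refine Finset.range_subset_range.2 ?_
    rw [← hx]
    exact Nat.le_mul_of_pos_right _ Nat.card_pos
  · rw [Finset.card_image_of_injOn, Finset.card_product, Finset.card_range, Finset.card_range]
    rintro ⟨j, i⟩ hp ⟨j', i'⟩ hq hpq
    simp only [Finset.coe_product, Finset.coe_range, Set.mem_prod, Set.mem_Iio] at hp hq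
    simp only [h.psTile_apply] at hpq
    obtain ⟨h1, h2⟩ := hT.column_eq_imp hH hx (j := ⟨j, hp.1⟩) (j' := ⟨j', hq.1⟩) hpq
    rw [ZMod.natCast_eq_natCast_iff', Nat.mod_eq_of_lt hp.2, Nat.mod_eq_of_lt hq.2] at h1
    exact Prod.ext (Fin.mk.inj h2) h1
  · rintro y ⟨J, -, -, hJ⟩
    have h1 : y * τ ≤ τ * x := by
      rw [← hJ, ← hT.card_image hH hx]
      refine Finset.card_le_card fun a ha => ?_
      obtain ⟨p, -, rfl⟩ := Finset.mem_image.1 ha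
      rw [h.psTile_apply]
      exact Finset.mem_image_of_mem _ (Finset.mem_univ _)
    rw [mul_comm τ] at h1
    exact Nat.le_of_mul_le_mul_right h1 (Nat.pos_of_neZero τ)

/-! ### Weak robustness -/

omit [NeZero τ] [NeZero σ] in
lemma chaseStep_iterate_fst {Y : Type*} (F : Y × Y → Y) (a : ZMod τ → Y) (k : ℕ)
    (v : ZMod τ × Y) : ((chaseStep F a)^[k] v).1 = v.1 + k := by
  induction k with
  | zero => simp
  | succ k ih =>
    rw [Function.iterate_succ_apply', chaseStep, ih]
    push_cast
    ring

omit [NeZero τ] [NeZero σ] in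
/-- If the column at `y` follows the tile from time `t` on, then the column at `y + 1` evolves
by iterating `chaseStep`. -/
lemma chaseStep_iterate_caTraj {η : ℤ → Fin n} {t : ℕ} {y : ℤ}
    (h : ∀ t' ≥ t, caTraj f η t' y = T ((t' : ZMod τ), (y : ZMod σ))) (k : ℕ) :
    (chaseStep (Function.uncurry f) fun i => T (i, (y : ZMod σ)))^[k]
        ((t : ZMod τ), caTraj f η t (y + 1)) =
      (((t + k : ℕ) : ZMod τ), caTraj f η (t + k) (y + 1)) := by
  induction k with
  | zero => simp
  | succ k ih =>
    rw [Function.iterate_succ_apply', ih, chaseStep, ← add_assoc, caTraj_succ_add_one,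
      h (t + k) (Nat.le_add_right _ _)]
    simp [Function.uncurry]

omit [NeZero σ] in
lemma chaseStep_mem_nextColumn {F : Fin n × Fin n → Fin n} (hc : Compat F T) {j : ZMod σ}
    {v : ZMod τ × Fin n} (hv : v ∈ nextColumn T j) :
    chaseStep F (fun i => T (i, j)) v ∈ nextColumn T j := by
  obtain ⟨i, c⟩ := v
  rw [mem_nextColumn] at hv
  rw [chaseStep, mem_nextColumn, hv]
  simpa using hc (i, j)

lemma caTraj_eq_of_le {η ζ : ℤ → Fin n} {y₀ : ℤ} {t : ℕ}
    (h : ∀ y ≤ y₀, caTraj f η t y = caTraj f ζ t y) {t' : ℕ} (ht : t ≤ t') :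
    ∀ y ≤ y₀, caTraj f η t' y = caTraj f ζ t' y := by
  induction t', ht using Nat.le_induction with
  | base => exact h
  | succ t' _ ih =>
    intro y hy
    rw [caTraj, caTraj, caStep, caStep, ih _ hy, ih _ (by omega)]

lemma Represents.absorbed_of_isWeaklyRobust (h : Represents f ξ T) (hw : IsWeaklyRobust f ξ)
    (j : ZMod σ) : Absorbed (Function.uncurry f) (fun i => T (i, j)) (nextColumn T j) := by
  obtain ⟨v, hv, hw⟩ := hw
  have h0 : ∀ c, ∃ k, (chaseStep (Function.uncurry f) fun i => T (i, j))^[k] (0, c) ∈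
      nextColumn T j := by
    intro c
    set y₀ : ℤ := (j.val : ℤ) with hy₀
    have hj : (y₀ : ZMod σ) = j := by simp [hy₀]
    let η : ℤ → Fin n := fun y => if y ≤ y₀ then ξ y else c
    have hη : ∀ y ≤ y₀, caTraj f η 0 y = caTraj f ξ 0 y := fun y hy => if_pos hy
    have hev := (hw η ⟨y₀, hη⟩).and
      ((tendsto_natCast_atTop_atTop (R := ℝ)).const_mul_atTop hv |>.eventually_ge_atTop
        ((y₀ + 1 : ℤ) : ℝ))
    obtain ⟨t, ht, hty⟩ := hev.exists
    refine ⟨t, ?_⟩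
    have h1 := chaseStep_iterate_caTraj (f := f) (η := η) (T := T) (t := 0) (y := y₀)
      (fun t' _ => by rw [caTraj_eq_of_le hη (Nat.zero_le _) y₀ le_rfl, h]) t
    have h2 : caTraj f η 0 (y₀ + 1) = c := if_neg (by omega)
    rw [h2, hj, zero_add, ht _ hty, h] at h1
    rw [Nat.cast_zero] at h1
    rw [h1, mem_nextColumn]
    simp [hj]
  intro v
  obtain ⟨k, hk⟩ := h0 ((chaseStep (Function.uncurry f) fun i => T (i, j))^[(-v.1).val] v).2
  refine ⟨k + (-v.1).val, ?_⟩
  rw [Function.iterate_add_apply]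
  convert hk using 2
  refine Prod.ext ?_ rfl
  rw [chaseStep_iterate_fst]
  simp

lemma Represents.isWeaklyRobust (h : Represents f ξ T)
    (ha : ∀ j, Absorbed (Function.uncurry f) (fun i => T (i, j)) (nextColumn T j)) :
    IsWeaklyRobust f ξ := by
  have hc := h.compat
  choose k hk using ha
  let K : ℕ := (∑ j, ∑ v, k j v) + 1
  have hK : ∀ j v, (chaseStep (Function.uncurry f) fun i => T (i, j))^[K] v ∈ nextColumn T j := by
    intro j v
    have hle : k j v ≤ K := by
      have h1 : k j v ≤ ∑ v, k j v := Finset.single_le_sum (fun _ _ => Nat.zero_le _)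
        (Finset.mem_univ v)
      have h2 : ∑ v, k j v ≤ ∑ j, ∑ v, k j v := Finset.single_le_sum
        (f := fun j => ∑ v, k j v) (fun _ _ => Nat.zero_le _) (Finset.mem_univ j)
      omega
    obtain ⟨m, hm⟩ := Nat.exists_eq_add_of_le' hle
    rw [hm, Function.iterate_add_apply]
    clear hm hle
    induction m with
    | zero => exact hk j v
    | succ m ih =>
      rw [Function.iterate_succ_apply']
      exact chaseStep_mem_nextColumn hc ih
  have hKpos : 0 < (K : ℝ) := by positivity
  refine ⟨1 / (2 * K), by positivity, fun η => ?_⟩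
  rintro ⟨y₀, hη⟩
  have hm : ∀ m : ℕ, ∀ y ≤ y₀ + m, caTraj f η (m * K) y = caTraj f ξ (m * K) y := by
    intro m
    induction m with
    | zero => simpa [caTraj] using hη
    | succ m ih =>
      intro y hy
      rw [Nat.succ_mul]
      by_cases hy' : y ≤ y₀ + m
      · exact caTraj_eq_of_le ih (Nat.le_add_right _ _) y hy'
      obtain rfl : y = y₀ + m + 1 := by push_cast at hy; omega
      have h1 := chaseStep_iterate_caTraj (f := f) (η := η) (T := T) (t := m * K) (y := y₀ + m)
        (fun t' ht' => by rw [caTraj_eq_of_le ih ht' _ le_rfl, h]) K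
      have h2 := hK ((y₀ + m : ℤ) : ZMod σ) (((m * K : ℕ) : ZMod τ), caTraj f η (m * K) (y₀ + m + 1))
      rw [h1, mem_nextColumn] at h2
      rw [h2, h]
      simp
  filter_upwards [(tendsto_natCast_atTop_atTop (R := ℝ)).eventually_ge_atTop (2 * K * (1 - y₀))]
    with t ht y hy
  have hle : y ≤ y₀ + (t / K : ℕ) := by
    have h1 : (t : ℝ) < K * ((t / K : ℕ) + 1) := by
      exact_mod_cast Nat.lt_mul_div_succ t (Nat.succ_pos _)
    generalize t / K = q at h1 ⊢
    by_contra! hlt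
    have h2 : (y₀ : ℝ) + q + 1 ≤ y := by exact_mod_cast Int.add_one_le_of_lt hlt
    rw [one_div_mul_eq_div, le_div_iff₀ (by positivity)] at hy
    nlinarith [mul_le_mul_of_nonneg_left h2 hKpos.le]
  exact caTraj_eq_of_le (hm (t / K)) (Nat.div_mul_le_self t K) y hle

theorem exists_wrps_iff (f : CARule n) :
    (∃ ξ : ℤ → Fin n, IsPS f ξ τ σ ∧ IsWeaklyRobust f ξ ∧ IsSimpleTile n τ σ (psTile f ξ) ∧
      tileRank n τ σ (psTile f ξ) = σ / Nat.gcd τ σ) ↔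
    ∃ H : AddSubgroup (ZMod τ × ZMod σ), (AxisFree H ∧ Nat.card H = Nat.gcd τ σ) ∧
      ∃ T : ZMod τ × ZMod σ → Fin n, IsTile H T ∧ RobustTile (Function.uncurry f) T := by
  have hσ : 0 < σ := Nat.pos_of_neZero σ
  constructor
  · rintro ⟨ξ, hps, hw, hs, hr⟩
    obtain ⟨T, hT⟩ := exists_represents hps
    obtain ⟨H, hH⟩ := exists_isTile hT.compat (hT.isSimpleTile_iff.1 hs)
    have hax := hT.axisFree hps hH
    have hx : σ / Nat.card H * Nat.card H = σ := Nat.div_mul_cancel hax.card_dvd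
    refine ⟨H, ⟨hax, ?_⟩, T, hH, hT.compat, hT.absorbed_of_isWeaklyRobust hw⟩
    rw [hT.tileRank_eq hH hax hx] at hr
    have h2 := Nat.div_mul_cancel (Nat.gcd_dvd_right τ σ)
    have hpos : 0 < σ / Nat.card H := Nat.pos_of_ne_zero fun h0 => by
      rw [h0, zero_mul] at hx; omega
    rw [← hr] at h2
    exact Nat.eq_of_mul_eq_mul_left hpos (hx.trans h2.symm)
  · rintro ⟨H, ⟨hax, hcard⟩, T, hH, hc, ha⟩
    have hT := hc.represents
    refine ⟨_, hT.isPS hH hax, hT.isWeaklyRobust ha,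
      hT.isSimpleTile_iff.2 fun u v huv => hH.add_right huv _, hT.tileRank_eq hH hax ?_⟩
    rw [hcard]
    exact Nat.div_mul_cancel (Nat.gcd_dvd_right τ σ)

end CellularAutomata

section Counting

open scoped Classical

variable {τ σ : ℕ} [NeZero τ] [NeZero σ]

/-- The period groups of simple tiles of minimal rank. -/
noncomputable def periodGroups (τ σ : ℕ) [NeZero τ] [NeZero σ] :
    Finset (AddSubgroup (ZMod τ × ZMod σ)) :=
  (Set.toFinite {H : AddSubgroup (ZMod τ × ZMod σ) |
    AxisFree H ∧ Nat.card H = Nat.gcd τ σ}).toFinset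

lemma mem_periodGroups {H : AddSubgroup (ZMod τ × ZMod σ)} :
    H ∈ periodGroups τ σ ↔ AxisFree H ∧ Nat.card H = Nat.gcd τ σ := by
  simp [periodGroups]

lemma periodGroups_nonempty : (periodGroups τ σ).Nonempty := by
  have hτ := Nat.pos_of_neZero τ
  have hσ := Nat.pos_of_neZero σ
  have hg : 0 < Nat.gcd τ σ := Nat.gcd_pos_of_pos_left _ hτ
  have horder : ∀ m : ℕ, 0 < m → Nat.gcd τ σ ∣ m →
      addOrderOf ((m / Nat.gcd τ σ : ℕ) : ZMod m) = Nat.gcd τ σ := fun m hm hd => by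
    rw [ZMod.addOrderOf_coe _ hm.ne', Nat.gcd_eq_right (Nat.div_dvd_of_dvd hd),
      Nat.div_div_self hd hm.ne']
  have h1 := horder τ hτ (Nat.gcd_dvd_left _ _)
  have h2 := horder σ hσ (Nat.gcd_dvd_right _ _)
  refine ⟨AddSubgroup.zmultiples (((τ / Nat.gcd τ σ : ℕ) : ZMod τ), ((σ / Nat.gcd τ σ : ℕ) : ZMod σ)),
    mem_periodGroups.2 ⟨⟨fun j hj => ?_, fun i hi => ?_⟩, ?_⟩⟩
  · obtain ⟨k, hk⟩ := AddSubgroup.mem_zmultiples_iff.1 hj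
    have h3 := congrArg Prod.fst hk
    have h4 := congrArg Prod.snd hk
    simp only [Prod.smul_fst] at h3
    simp only [Prod.smul_snd] at h4
    rw [← h4, ← addOrderOf_dvd_iff_zsmul_eq_zero, h2, ← h1]
    exact addOrderOf_dvd_iff_zsmul_eq_zero.2 h3
  · obtain ⟨k, hk⟩ := AddSubgroup.mem_zmultiples_iff.1 hi
    have h3 := congrArg Prod.fst hk
    have h4 := congrArg Prod.snd hk
    simp only [Prod.smul_fst] at h3
    simp only [Prod.smul_snd] at h4
    rw [← h3, ← addOrderOf_dvd_iff_zsmul_eq_zero, h1, ← h2]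
    exact addOrderOf_dvd_iff_zsmul_eq_zero.2 h4
  · rw [Nat.card_zmultiples, Prod.addOrderOf_mk, h1, h2, Nat.lcm_self]

lemma mul_card_of_mem_periodGroups {H : AddSubgroup (ZMod τ × ZMod σ)}
    (hH : H ∈ periodGroups τ σ) : σ / Nat.gcd τ σ * Nat.card H = σ := by
  rw [(mem_periodGroups.1 hH).2]
  exact Nat.div_mul_cancel (Nat.gcd_dvd_right τ σ)

variable (τ σ) in
/-- The simple tiles of minimal rank. -/
noncomputable def minimalTiles (Y : Type*) [Fintype Y] [DecidableEq Y] : Finset (ZMod τ × ZMod σ → Y) :=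
  (periodGroups τ σ).biUnion fun H => Finset.univ.filter fun T => IsTile H T

variable {Y : Type*} [Fintype Y] [DecidableEq Y]

lemma mem_minimalTiles {T : ZMod τ × ZMod σ → Y} :
    T ∈ minimalTiles τ σ Y ↔ ∃ H ∈ periodGroups τ σ, IsTile H T := by
  simp [minimalTiles]

lemma card_minimalTiles : (minimalTiles τ σ Y).card =
    (periodGroups τ σ).card * (Fintype.card Y).descFactorial (τ * (σ / Nat.gcd τ σ)) := by
  rw [minimalTiles, Finset.card_biUnion, ← smul_eq_mul, ← Finset.sum_const]
  · refine Finset.sum_congr rfl fun H hH => ?_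
    rw [← card_isTile (mem_periodGroups.1 hH).1 (mul_card_of_mem_periodGroups hH),
      Nat.card_eq_fintype_card, Fintype.card_subtype]
  · intro H _ H' _ hne
    rw [Function.onFun, Finset.disjoint_left]
    intro T hT hT'
    exact hne ((Finset.mem_filter.1 hT).2.unique (Finset.mem_filter.1 hT').2)

/-- The translates of a tile. -/
noncomputable def translates (T : ZMod τ × ZMod σ → Y) : Finset (ZMod τ × ZMod σ → Y) :=
  Finset.univ.image fun w u => T (u + w)

lemma card_translates {T : ZMod τ × ZMod σ → Y} (hT : T ∈ minimalTiles τ σ Y) :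
    (translates T).card = τ * (σ / Nat.gcd τ σ) := by
  obtain ⟨H, hH, hT⟩ := mem_minimalTiles.1 hT
  rw [← hT.card_image (mem_periodGroups.1 hH).1 (mul_card_of_mem_periodGroups hH)]
  have h1 : Finset.univ.image T = (translates T).image fun T' => T' 0 := by
    rw [translates, Finset.image_image]
    congr 1
    funext w
    simp
  rw [h1, Finset.card_image_of_injOn]
  intro T₁ h₁ T₂ h₂ h12
  obtain ⟨w₁, -, rfl⟩ := Finset.mem_image.1 (Finset.mem_coe.1 h₁)
  obtain ⟨w₂, -, rfl⟩ := Finset.mem_image.1 (Finset.mem_coe.1 h₂)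
  funext u
  simp only [zero_add] at h12
  simpa only [add_comm u] using hT.add_right h12 u

lemma mem_minimalTiles_of_mem_translates {T T' : ZMod τ × ZMod σ → Y}
    (hT : T ∈ minimalTiles τ σ Y) (h : T' ∈ translates T) : T' ∈ minimalTiles τ σ Y := by
  obtain ⟨H, hH, hT⟩ := mem_minimalTiles.1 hT
  obtain ⟨w, -, rfl⟩ := Finset.mem_image.1 h
  exact mem_minimalTiles.2 ⟨H, hH, hT.translate w⟩

/-- The robust tiles of `f` come in full translation classes, and all but one class are counted
by the pairs of tiles that are not translates of each other. -/
lemma card_robustTile_bounds (f : Y × Y → Y) :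
    (τ * (σ / Nat.gcd τ σ)) * (if ∃ T ∈ minimalTiles τ σ Y, RobustTile f T then 1 else 0) ≤
        ∑ T ∈ minimalTiles τ σ Y, (if RobustTile f T then 1 else 0) ∧
      ∑ T ∈ minimalTiles τ σ Y, (if RobustTile f T then 1 else 0) ≤
        (τ * (σ / Nat.gcd τ σ)) * (if ∃ T ∈ minimalTiles τ σ Y, RobustTile f T then 1 else 0) +
        ∑ T ∈ minimalTiles τ σ Y, ∑ T' ∈ (minimalTiles τ σ Y).filter (· ∉ translates T),
          if RobustTile f T ∧ RobustTile f T' then 1 else 0 := by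
  by_cases hex : ∃ T ∈ minimalTiles τ σ Y, RobustTile f T
  · rw [if_pos hex, mul_one]
    obtain ⟨T, hT, hf⟩ := hex
    have hsub : translates T ⊆ (minimalTiles τ σ Y).filter (RobustTile f) := fun T' h' => by
      refine Finset.mem_filter.2 ⟨mem_minimalTiles_of_mem_translates hT h', ?_⟩
      obtain ⟨w, -, rfl⟩ := Finset.mem_image.1 h'
      exact hf.translate w
    rw [← Finset.card_filter, ← card_translates hT]
    refine ⟨Finset.card_le_card hsub, ?_⟩
    have h1 : (((minimalTiles τ σ Y).filter (· ∉ translates T)).filter (RobustTile f)).card ≤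
        ∑ T ∈ minimalTiles τ σ Y, ∑ T' ∈ (minimalTiles τ σ Y).filter (· ∉ translates T),
          if RobustTile f T ∧ RobustTile f T' then 1 else 0 := by
      refine le_trans ?_ (Finset.single_le_sum (fun _ _ => Nat.zero_le _) hT)
      rw [Finset.card_filter]
      simp only [hf, true_and, le_refl]
    refine le_trans (le_trans (Finset.card_le_card ?_) (Finset.card_union_le _ _))
      (Nat.add_le_add_left h1 _)
    intro T' h'
    simp only [Finset.mem_union, Finset.mem_filter] at h' ⊢
    tauto
  · rw [if_neg hex, Finset.sum_eq_zero]
    · simp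
    · intro T hT
      exact if_neg fun hf => hex ⟨T, hT, hf⟩

lemma sum_pr_bounds :
    ((τ * (σ / Nat.gcd τ σ) : ℕ) : ℝ) *
        pr (fun f : Y × Y → Y => ∃ T ∈ minimalTiles τ σ Y, RobustTile f T) ≤
        ∑ T ∈ minimalTiles τ σ Y, pr (fun f : Y × Y → Y => RobustTile f T) ∧
      ∑ T ∈ minimalTiles τ σ Y, pr (fun f : Y × Y → Y => RobustTile f T) ≤
        ((τ * (σ / Nat.gcd τ σ) : ℕ) : ℝ) *
          pr (fun f : Y × Y → Y => ∃ T ∈ minimalTiles τ σ Y, RobustTile f T) +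
        ∑ T ∈ minimalTiles τ σ Y, ∑ T' ∈ (minimalTiles τ σ Y).filter (· ∉ translates T),
          pr (fun f : Y × Y → Y => RobustTile f T ∧ RobustTile f T') := by
  simp only [pr_eq_sum]
  simp only [← Finset.sum_div, mul_div_assoc', ← add_div, Finset.mul_sum]
  rw [Finset.sum_comm]
  have hcomm : ∑ T ∈ minimalTiles τ σ Y, ∑ T' ∈ (minimalTiles τ σ Y).filter (· ∉ translates T),
      ∑ f : Y × Y → Y, (if RobustTile f T ∧ RobustTile f T' then (1 : ℝ) else 0) =
      ∑ f : Y × Y → Y, ∑ T ∈ minimalTiles τ σ Y,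
        ∑ T' ∈ (minimalTiles τ σ Y).filter (· ∉ translates T),
        if RobustTile f T ∧ RobustTile f T' then (1 : ℝ) else 0 := by
    rw [Finset.sum_comm]
    exact Finset.sum_congr rfl fun T _ => Finset.sum_comm
  rw [hcomm, ← Finset.sum_add_distrib]
  constructor
  · gcongr with f _
    exact_mod_cast (card_robustTile_bounds f).1
  · gcongr with f _
    exact_mod_cast (card_robustTile_bounds f).2

variable [Nonempty Y]

lemma sum_pr_robustTile :
    ∑ T ∈ minimalTiles τ σ Y, pr (fun f : Y × Y → Y => RobustTile f T) =
      (minimalTiles τ σ Y).card * ((1 / (Fintype.card Y : ℝ)) ^ (τ * (σ / Nat.gcd τ σ)) *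
        (1 - (1 - 1 / (Fintype.card Y : ℝ)) ^ τ) ^ (σ / Nat.gcd τ σ)) := by
  rw [← nsmul_eq_mul, ← Finset.sum_const]
  refine Finset.sum_congr rfl fun T hT => ?_
  obtain ⟨H, hH, hT⟩ := mem_minimalTiles.1 hT
  exact pr_robustTile hT (mem_periodGroups.1 hH).1 (mul_card_of_mem_periodGroups hH)

lemma sum_prod_weight_le {x : ℕ} {H : AddSubgroup (ZMod τ × ZMod σ)} (hH : AxisFree H)
    (hx : x * Nat.card H = σ) (S : Finset Y) :
    ∑ T ∈ Finset.univ.filter (fun T : ZMod τ × ZMod σ → Y => IsTile H T),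
      ∏ p : ZMod τ × Fin x, (if T (repSite p) ∈ S then 1 else 1 / (Fintype.card Y : ℝ)) ≤
      (S.card + 1 : ℝ) ^ (τ * x) := by
  have hw : ∀ y, (0 : ℝ) ≤ if y ∈ S then 1 else 1 / (Fintype.card Y : ℝ) := fun y => by
    split_ifs <;> positivity
  calc _ = ∑ φ ∈ (Finset.univ.filter fun T : ZMod τ × ZMod σ → Y => IsTile H T).image
          fun T (p : ZMod τ × Fin x) => T (repSite p),
          ∏ p, (if φ p ∈ S then 1 else 1 / (Fintype.card Y : ℝ)) := by
        rw [Finset.sum_image]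
        intro T hT T' hT' he
        have hT := (Finset.mem_filter.1 (Finset.mem_coe.1 hT)).2
        have hT' := (Finset.mem_filter.1 (Finset.mem_coe.1 hT')).2
        funext u
        obtain ⟨p, hp⟩ := hH.exists_repSite hx u
        rw [(hT _ _).2 hp, (hT' _ _).2 hp]
        exact congrFun he p
    _ ≤ ∑ φ : ZMod τ × Fin x → Y, ∏ p, (if φ p ∈ S then 1 else 1 / (Fintype.card Y : ℝ)) :=
        Finset.sum_le_sum_of_subset_of_nonneg (Finset.subset_univ _) fun φ _ _ =>
          Finset.prod_nonneg fun p _ => hw _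
    _ = (∑ y, if y ∈ S then 1 else 1 / (Fintype.card Y : ℝ)) ^ (τ * x) := by
        rw [← Fintype.piFinset_univ, ← Finset.prod_univ_sum (fun _ => Finset.univ)
          (fun _ y => if y ∈ S then 1 else 1 / (Fintype.card Y : ℝ)), Finset.prod_const,
          Finset.card_univ, Fintype.card_prod, ZMod.card, Fintype.card_fin]
    _ ≤ _ := by
        refine pow_le_pow_left₀ (Finset.sum_nonneg fun y _ => hw y) ?_ _
        calc _ ≤ ∑ y : Y, ((if y ∈ S then 1 else 0) + 1 / (Fintype.card Y : ℝ)) := by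
              refine Finset.sum_le_sum fun y _ => ?_
              split_ifs
              · have : 0 ≤ 1 / (Fintype.card Y : ℝ) := by positivity
                linarith
              · simp
          _ = _ := by
              have : (Fintype.card Y : ℝ) ≠ 0 := by exact_mod_cast Fintype.card_ne_zero
              rw [Finset.sum_add_distrib, Finset.sum_boole, Finset.sum_const, nsmul_eq_mul,
                Finset.card_univ, mul_one_div_cancel this]
              simp

lemma sum_pr_pair_le :
    ∑ T ∈ minimalTiles τ σ Y, ∑ T' ∈ (minimalTiles τ σ Y).filter (· ∉ translates T),
      pr (fun f : Y × Y → Y => RobustTile f T ∧ RobustTile f T') ≤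
    (minimalTiles τ σ Y).card * (((1 / (Fintype.card Y : ℝ)) ^ (τ * (σ / Nat.gcd τ σ)) *
      (((τ + 1) / (Fintype.card Y : ℝ)) ^ (σ / Nat.gcd τ σ) * (1 / (Fintype.card Y : ℝ)) *
        (τ + 1) ^ (σ / Nat.gcd τ σ))) * ((periodGroups τ σ).card *
      (((τ * (σ / Nat.gcd τ σ) : ℕ) : ℝ) + 1) ^ (τ * (σ / Nat.gcd τ σ)))) := by
  set x := σ / Nat.gcd τ σ with hxdef
  have hx0 : 1 ≤ x := Nat.div_pos (Nat.le_of_dvd (Nat.pos_of_neZero σ) (Nat.gcd_dvd_right _ _))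
    (Nat.gcd_pos_of_pos_left _ (Nat.pos_of_neZero τ))
  rw [← nsmul_eq_mul]
  refine Finset.sum_le_card_nsmul _ _ _ fun T hT => ?_
  have hTH := mem_minimalTiles.1 hT
  obtain ⟨H, hH, hTt⟩ := hTH
  have hS : (Finset.univ.image T).card = τ * x :=
    hTt.card_image (mem_periodGroups.1 hH).1 (mul_card_of_mem_periodGroups hH)
  have hw : ∀ y, (0 : ℝ) ≤ if y ∈ Finset.univ.image T then 1 else 1 / (Fintype.card Y : ℝ) :=
    fun y => by split_ifs <;> positivity
  set A : ℝ := (1 / (Fintype.card Y : ℝ)) ^ (τ * x) *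
      (((τ + 1) / (Fintype.card Y : ℝ)) ^ x * (1 / (Fintype.card Y : ℝ)) * (τ + 1) ^ x) with hA
  calc _ ≤ ∑ T' ∈ (minimalTiles τ σ Y).filter (· ∉ translates T),
        A * ∏ p : ZMod τ × Fin x,
          (if T' (repSite p) ∈ Finset.univ.image T then 1 else 1 / (Fintype.card Y : ℝ)) := by
        refine Finset.sum_le_sum fun T' hT' => ?_
        obtain ⟨hT', hne⟩ := Finset.mem_filter.1 hT'
        obtain ⟨H', hH', hTt'⟩ := mem_minimalTiles.1 hT'
        refine (pr_robustTile_pair_le hTt (mem_periodGroups.1 hH).1 (mul_card_of_mem_periodGroups hH)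
          hTt' (mem_periodGroups.1 hH').1 (mul_card_of_mem_periodGroups hH') hx0
          fun w hw => hne ?_).trans_eq ?_
        · exact Finset.mem_image.2 ⟨w, Finset.mem_univ _, hw.symm⟩
        · simp [hA, x]
    _ ≤ ∑ T' ∈ minimalTiles τ σ Y,
        A * ∏ p : ZMod τ × Fin x,
          (if T' (repSite p) ∈ Finset.univ.image T then 1 else 1 / (Fintype.card Y : ℝ)) :=
        Finset.sum_le_sum_of_subset_of_nonneg (Finset.filter_subset _ _) fun T' _ _ =>
          mul_nonneg (by positivity) (Finset.prod_nonneg fun p _ => hw _)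
    _ = A * ∑ T' ∈ minimalTiles τ σ Y, ∏ p : ZMod τ × Fin x,
          (if T' (repSite p) ∈ Finset.univ.image T then 1 else 1 / (Fintype.card Y : ℝ)) := by
        rw [Finset.mul_sum]
    _ ≤ A * ((periodGroups τ σ).card * (((τ * x : ℕ) : ℝ) + 1) ^ (τ * x)) := by
        refine mul_le_mul_of_nonneg_left ?_ (by positivity)
        rw [minimalTiles, Finset.sum_biUnion]
        · rw [← nsmul_eq_mul]
          refine Finset.sum_le_card_nsmul _ _ _ fun H' hH' => ?_
          rw [← hS]
          refine (sum_prod_weight_le (mem_periodGroups.1 hH').1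
            (mul_card_of_mem_periodGroups hH') _).trans ?_
          rw [hS]
        · intro H _ H' _ hne
          rw [Function.onFun, Finset.disjoint_left]
          intro T hT hT'
          exact hne ((Finset.mem_filter.1 hT).2.unique (Finset.mem_filter.1 hT').2)

end Counting

section Limits

lemma tendsto_descFactorial_div_pow (s : ℕ) :
    Tendsto (fun n : ℕ => (n.descFactorial s : ℝ) / (n : ℝ) ^ s) atTop (nhds 1) := by
  induction s with
  | zero => simp
  | succ s ih =>
    have h1 : Tendsto (fun n : ℕ => (1 : ℝ) - s / n) atTop (nhds (1 - 0)) :=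
      tendsto_const_nhds.sub (tendsto_const_div_atTop_nhds_zero_nat _)
    have h2 := h1.mul ih
    rw [sub_zero, one_mul] at h2
    refine h2.congr' ?_
    filter_upwards [eventually_ge_atTop (s + 1)] with n hn
    have hn0 : (n : ℝ) ≠ 0 := by
      have : n ≠ 0 := by omega
      exact_mod_cast this
    rw [Nat.descFactorial_succ, Nat.cast_mul, Nat.cast_sub (by omega)]
    field_simp
    ring

lemma tendsto_mul_one_sub_pow (τ : ℕ) :
    Tendsto (fun n : ℕ => (n : ℝ) * (1 - (1 - 1 / (n : ℝ)) ^ τ)) atTop (nhds τ) := by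
  have h1 : Tendsto (fun n : ℕ => ∑ i ∈ Finset.range τ, (1 - 1 / (n : ℝ)) ^ i) atTop
      (nhds (∑ i ∈ Finset.range τ, (1 - 0) ^ i)) :=
    tendsto_finsetSum _ fun i _ =>
      (tendsto_const_nhds.sub (tendsto_const_div_atTop_nhds_zero_nat (1 : ℝ))).pow i
  simp only [sub_zero, one_pow, Finset.sum_const, Finset.card_range, nsmul_eq_mul, mul_one] at h1
  refine h1.congr' ?_
  filter_upwards [eventually_ge_atTop 1] with n hn
  have hn0 : (n : ℝ) ≠ 0 := by
    have : n ≠ 0 := by omega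
    exact_mod_cast this
  rw [← mul_neg_geom_sum, sub_sub_cancel, ← mul_assoc, mul_one_div_cancel hn0, one_mul]

end Limits

lemma wrps_probability_eq (n τ σ : ℕ) [NeZero τ] [NeZero σ] :
    (Nat.card {f : CARule n // ∃ ξ : ℤ → Fin n, IsPS f ξ τ σ ∧ IsWeaklyRobust f ξ ∧
        IsSimpleTile n τ σ (psTile f ξ) ∧ tileRank n τ σ (psTile f ξ) = σ / Nat.gcd τ σ} : ℝ) /
      (n : ℝ) ^ (n ^ 2) =
    pr fun f : Fin n × Fin n → Fin n => ∃ T ∈ minimalTiles τ σ (Fin n), RobustTile f T := by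
  rw [← pr_equiv (Equiv.curry (Fin n) (Fin n) (Fin n)).symm, pr]
  congr 1
  · congr 1
    refine Nat.card_congr (Equiv.subtypeEquivRight fun f => ?_)
    rw [exists_wrps_iff]
    simp only [mem_minimalTiles, mem_periodGroups]
    constructor
    · rintro ⟨H, hH, T, hT, hf⟩
      exact ⟨T, ⟨H, hH, hT⟩, hf⟩
    · rintro ⟨T, ⟨H, hH, hT⟩, hf⟩
      exact ⟨H, hH, T, hT, hf⟩
  · simp only [Fintype.card_pi, Finset.prod_const, Finset.card_univ, Fintype.card_fin]
    push_cast
    rw [← pow_mul, sq]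

/-- with `x = σ/gcd(τ,σ)`, the probability that a uniformly random
`n`-state rule has a weakly robust periodic solution with periods `τ, σ` whose
tile is simple of rank `x` is `c(τ,σ)/n^x + o(1/n^x)` with `c(τ,σ) > 0`. -/
theorem minimal_rank_wrps_probability (τ σ : ℕ) (hτ : 1 ≤ τ) (hσ : 1 ≤ σ) :
    ∃ c : ℝ, 0 < c ∧ Filter.Tendsto
      (fun n : ℕ => (n : ℝ) ^ (σ / Nat.gcd τ σ) *
        ((Nat.card {f : CARule n // ∃ ξ : ℤ → Fin n,
            IsPS f ξ τ σ ∧ IsWeaklyRobust f ξ ∧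
            IsSimpleTile n τ σ (psTile f ξ) ∧
            tileRank n τ σ (psTile f ξ) = σ / Nat.gcd τ σ} : ℝ) /
          (n : ℝ) ^ (n ^ 2)))
      Filter.atTop (nhds c) := by
  have : NeZero τ := ⟨by omega⟩
  have : NeZero σ := ⟨by omega⟩
  simp only [wrps_probability_eq]
  set x := σ / Nat.gcd τ σ with hxdef
  have hx0 : 1 ≤ x := Nat.div_pos (Nat.le_of_dvd hσ (Nat.gcd_dvd_right _ _))
    (Nat.gcd_pos_of_pos_left _ hτ)
  set s := τ * x with hs
  have hspos : (0 : ℝ) < s := by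
    have : 0 < s := Nat.mul_pos hτ hx0
    exact_mod_cast this
  set h : ℝ := ((periodGroups τ σ).card : ℝ) with hh
  have hhpos : 0 < h := by
    rw [hh]
    exact_mod_cast (periodGroups_nonempty (τ := τ) (σ := σ)).card_pos
  let q : ℕ → ℝ := fun n =>
    pr fun f : Fin n × Fin n → Fin n => ∃ T ∈ minimalTiles τ σ (Fin n), RobustTile f T
  let E : ℕ → ℝ := fun n => h * ((n.descFactorial s : ℝ) / (n : ℝ) ^ s) *
    ((n : ℝ) * (1 - (1 - 1 / (n : ℝ)) ^ τ)) ^ x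
  let C : ℝ := h * h * ((τ + 1) ^ x * (τ + 1) ^ x) * ((s : ℝ) + 1) ^ s
  have hE : Tendsto E atTop (nhds (h * τ ^ x)) := by
    have := ((tendsto_descFactorial_div_pow s).const_mul h).mul
      ((tendsto_mul_one_sub_pow τ).pow x)
    rwa [mul_one] at this
  have hbounds : ∀ n : ℕ, 1 ≤ n → (E n - C / n) / s ≤ (n : ℝ) ^ x * q n ∧
      (n : ℝ) ^ x * q n ≤ E n / s := by
    intro n hn
    have : Nonempty (Fin n) := ⟨⟨0, hn⟩⟩
    have hn0 : (0 : ℝ) < n := by exact_mod_cast hn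
    obtain ⟨h1, h2⟩ := sum_pr_bounds (τ := τ) (σ := σ) (Y := Fin n)
    have h3 := sum_pr_pair_le (τ := τ) (σ := σ) (Y := Fin n)
    rw [sum_pr_robustTile, card_minimalTiles, Fintype.card_fin,
      Nat.cast_mul (periodGroups τ σ).card, ← hxdef, ← hs, ← hh] at h1 h2
    rw [card_minimalTiles, Fintype.card_fin, Nat.cast_mul (periodGroups τ σ).card, ← hxdef, ← hs,
      ← hh] at h3
    have hEq : (n : ℝ) ^ x * (h * (n.descFactorial s : ℝ) *
        ((1 / (n : ℝ)) ^ s * (1 - (1 - 1 / (n : ℝ)) ^ τ) ^ x)) = E n := by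
      simp only [E, mul_pow, inv_pow, div_eq_mul_inv]
      ring
    have hdesc : (n.descFactorial s : ℝ) ≤ (n : ℝ) ^ s := by
      exact_mod_cast Nat.descFactorial_le_pow n s
    have hC : (n : ℝ) ^ x * (h * (n.descFactorial s : ℝ) * (((1 / (n : ℝ)) ^ s *
        (((τ + 1) / (n : ℝ)) ^ x * (1 / (n : ℝ)) * (τ + 1) ^ x)) *
          (h * ((s : ℝ) + 1) ^ s))) ≤ C / n := by
      calc _ ≤ (n : ℝ) ^ x * (h * (n : ℝ) ^ s * (((1 / (n : ℝ)) ^ s *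
          (((τ + 1) / (n : ℝ)) ^ x * (1 / (n : ℝ)) * (τ + 1) ^ x)) *
            (h * ((s : ℝ) + 1) ^ s))) := by gcongr
        _ = C / n := by
          simp only [C, div_pow, one_pow]
          field_simp
    have hnx : (0 : ℝ) < (n : ℝ) ^ x := by positivity
    have h1' := mul_le_mul_of_nonneg_left h1 hnx.le
    have h2' := mul_le_mul_of_nonneg_left (h2.trans (add_le_add_right h3 _)) hnx.le
    rw [hEq] at h1'
    rw [hEq, mul_add] at h2'
    rw [div_le_iff₀ hspos, le_div_iff₀ hspos]
    constructor
    · have := h2'.trans (add_le_add_right hC _)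
      simp only [q]
      linarith
    · simp only [q]
      linarith
  refine ⟨h * τ ^ x / s, by positivity, ?_⟩
  refine tendsto_of_tendsto_of_tendsto_of_le_of_le' (g := fun n => (E n - C / n) / s)
    (h := fun n => E n / s) ?_ (hE.div_const _) ?_ ?_
  · have := (hE.sub (tendsto_const_div_atTop_nhds_zero_nat C)).div_const (s : ℝ)
    rwa [sub_zero] at this
  · filter_upwards [eventually_ge_atTop 1] with n hn using (hbounds n hn).1
  · filter_upwards [eventually_ge_atTop 1] with n hn using (hbounds n hn).2
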